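/- arXiv:1011.2175 — 3 statements merged into one kernel-verified Lean document; each statement's English description precedes it below -/
import Mathlib

section
/- Let f be a real polynomial of degree n with nonzero leading coefficient, let K be the number of sign changes and L the number of nonzero members of the revised sign list of the discriminant sequence {ⁿD₁, …, ⁿDₙ} of f. Then f has exactly K distinct pairs of complex-conjugate non-real roots (i.e. exactly 2K distinct non-real complex roots) and exactly L − 2K distinct real roots. -/
open Polynomial Matrix

/-- Entry `(r, c)` (0-indexed) of the `(2n+1) × (2n+1)` discrimination matrix of a
degree-`n` polynomial whose coefficient sequence is `a` (`a i` = coefficient of `x^(n-i)`):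
odd-numbered rows (1-indexed) carry the coefficients of `f`, even-numbered rows those of `f'`. -/
noncomputable def discEntry (n : ℕ) (a : ℕ → ℝ) (r c : ℕ) : ℝ :=
  if r % 2 = 0 then
    if r / 2 ≤ c ∧ c ≤ r / 2 + n then a (c - r / 2) else 0
  else
    if (r + 1) / 2 ≤ c ∧ c + 1 ≤ (r + 1) / 2 + n then
      ((n - (c - (r + 1) / 2) : ℕ) : ℝ) * a (c - (r + 1) / 2)
    else 0

/-- The `j`-th leading principal minor `d_j` of the discrimination matrix. -/
noncomputable def discMinor (n : ℕ) (a : ℕ → ℝ) (j : ℕ) : ℝ :=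
  Matrix.det (Matrix.of fun r c : Fin j => discEntry n a r.val c.val)

/-- `ⁿD_i = d_{2i}`, the `i`-th member of the discriminant sequence. -/
noncomputable def discD (n : ℕ) (a : ℕ → ℝ) (i : ℕ) : ℝ :=
  discMinor n a (2 * i)

/-- The coefficient sequence of a degree-`n` polynomial: `a i` = coefficient of `x^(n-i)`. -/
noncomputable def coeffSeq (n : ℕ) (f : Polynomial ℝ) (i : ℕ) : ℝ :=
  f.coeff (n - i)

/-- `ⁿD_i` of the discriminant sequence of a degree-`n` real polynomial. -/
noncomputable def polyDiscD (n : ℕ) (f : Polynomial ℝ) (i : ℕ) : ℝ :=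
  discD n (coeffSeq n f) i

/-- Integer sign of a real number. -/
noncomputable def rsign (x : ℝ) : ℤ :=
  if 0 < x then 1 else if x < 0 then -1 else 0

/-- The sign list `[sign(ⁿD₁), …, sign(ⁿDₙ)]` of the discriminant sequence. -/
noncomputable def signList (n : ℕ) (a : ℕ → ℝ) : List ℤ :=
  (List.range n).map fun i => rsign (discD n a (i + 1))

/-- The pattern `-s, -s, s, s, -s, -s, s, s, …` (for `s = 1`) used when revising sign lists;
`zpattern i` is the value replacing the `i`-th zero (1-indexed) of an internal zero run. -/
def zpattern (i : ℕ) : ℤ := (-1) ^ ((i + 1) / 2)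

/-- The entry at position `p` (0-indexed) of the revised sign list of `L`: nonzero entries are
kept; a zero lying in an internal run of zeros (i.e. preceded by some nonzero entry `s` and
followed by some nonzero entry) is replaced according to the pattern `-s, -s, s, s, …`;
zeros at the end (or the beginning) are left unchanged. -/
def reviseAt (L : List ℤ) (p : ℕ) : ℤ :=
  if L.getD p 0 ≠ 0 then L.getD p 0
  else
    match (List.range p).reverse.find? (fun q => L.getD q 0 != 0) with
    | none => 0
    | some q =>
        if (List.range L.length).any (fun s => decide (p < s) && (L.getD s 0 != 0)) then
          zpattern (p - q) * L.getD q 0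
        else 0

/-- The revised sign list of a sign list `L`. -/
def revisedSignList (L : List ℤ) : List ℤ :=
  (List.range L.length).map (reviseAt L)

/-- The number of sign changes of a (revised) sign list. -/
def signChanges (L : List ℤ) : ℕ :=
  (List.range (L.length - 1)).countP fun i =>
    decide (L.getD i 0 * L.getD (i + 1) 0 < 0)

/-- The number of nonzero members of a list. -/
def nonzeroCount (L : List ℤ) : ℕ := L.countP fun x => x != 0


/-! ### Hankel forms -/

/-- Hankel matrix of a linear functional. -/
noncomputable def hkM (ℓ : ℝ[X] →ₗ[ℝ] ℝ) (k : ℕ) : Matrix (Fin k) (Fin k) ℝ :=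
  Matrix.of fun i j => ℓ (X ^ ((i : ℕ) + (j : ℕ)))

/-- Existence of positive and negative definite subspaces of given dimensions. -/
def Inert (ℓ : ℝ[X] →ₗ[ℝ] ℝ) (k a b : ℕ) : Prop :=
  ∃ P N : Submodule ℝ ℝ[X], P ≤ degreeLT ℝ k ∧ N ≤ degreeLT ℝ k ∧
    Module.finrank ℝ P = a ∧ Module.finrank ℝ N = b ∧
    (∀ p ∈ P, p ≠ 0 → 0 < ℓ (p * p)) ∧ (∀ p ∈ N, p ≠ 0 → ℓ (p * p) < 0)

/-- polynomial from coefficient vector -/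
noncomputable def tp (k : ℕ) : (Fin k → ℝ) →ₗ[ℝ] ℝ[X] :=
  Fintype.linearCombination ℝ (fun i : Fin k => (X : ℝ[X]) ^ (i : ℕ))

lemma tp_apply (k : ℕ) (v : Fin k → ℝ) : tp k v = ∑ i, v i • (X : ℝ[X]) ^ (i : ℕ) := by
  simp [tp, Fintype.linearCombination_apply]

lemma tp_coeff (k : ℕ) (v : Fin k → ℝ) (i : Fin k) : (tp k v).coeff i = v i := by
  rw [tp_apply]
  simp [Polynomial.finsetSum_coeff, Polynomial.coeff_X_pow]
  rw [Finset.sum_eq_single i] <;> simp +contextual [Fin.ext_iff, eq_comm]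

lemma tp_inj (k : ℕ) : Function.Injective (tp k) := by
  intro v w h
  ext i
  rw [← tp_coeff k v, ← tp_coeff k w, h]

lemma tp_mem (k : ℕ) (v : Fin k → ℝ) : tp k v ∈ degreeLT ℝ k := by
  rw [tp_apply]
  refine Submodule.sum_mem _ fun i _ => Submodule.smul_mem _ _ ?_
  rw [mem_degreeLT]
  refine lt_of_le_of_lt (degree_X_pow_le _) ?_
  exact_mod_cast i.2

lemma tp_surj (k : ℕ) (p : ℝ[X]) (hp : p ∈ degreeLT ℝ k) : tp k (fun i => p.coeff i) = p := by
  ext m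
  by_cases hm : m < k
  · exact tp_coeff k _ ⟨m, hm⟩
  · rw [mem_degreeLT] at hp
    have h2 := tp_mem k (fun i => p.coeff i)
    rw [mem_degreeLT] at h2
    have hk : (k : WithBot ℕ) ≤ m := by exact_mod_cast not_lt.mp hm
    rw [coeff_eq_zero_of_degree_lt (lt_of_lt_of_le hp hk),
      coeff_eq_zero_of_degree_lt (lt_of_lt_of_le h2 hk)]

lemma tp_form (ℓ : ℝ[X] →ₗ[ℝ] ℝ) (k : ℕ) (v w : Fin k → ℝ) :
    ℓ (tp k v * tp k w) = v ⬝ᵥ (hkM ℓ k *ᵥ w) := by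
  rw [tp_apply, tp_apply, Finset.sum_mul_sum]
  simp only [map_sum, dotProduct, Matrix.mulVec, hkM, Matrix.of_apply, Finset.mul_sum]
  refine Finset.sum_congr rfl fun i _ => Finset.sum_congr rfl fun j _ => ?_
  rw [smul_mul_smul_comm, ← pow_add, map_smul, smul_eq_mul]
  ring

lemma posdef_span {ι : Type} [Fintype ι] [DecidableEq ι] (ℓ : ℝ[X] →ₗ[ℝ] ℝ) (e : ι → ℝ[X])
    (lam : ι → ℝ)
    (he : ∀ i j, ℓ (e i * e j) = if i = j then lam i else 0) (hpos : ∀ i, 0 < lam i)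
    (p : ℝ[X]) (hp : p ∈ Submodule.span ℝ (Set.range e)) (h0 : p ≠ 0) : 0 < ℓ (p * p) := by
  rw [Submodule.mem_span_range_iff_exists_fun] at hp
  obtain ⟨c, rfl⟩ := hp
  have : ℓ ((∑ i, c i • e i) * (∑ i, c i • e i)) = ∑ i, c i ^ 2 * lam i := by
    rw [Finset.sum_mul_sum]
    simp only [map_sum, smul_mul_smul_comm, map_smul, he, smul_eq_mul]
    simp [pow_two]
  rw [this]
  have hc : ∃ i, c i ≠ 0 := by
    by_contra! h
    apply h0
    simp [h]
  obtain ⟨i, hi⟩ := hc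
  refine Finset.sum_pos' (fun i _ => mul_nonneg (sq_nonneg _) (hpos i).le) ⟨i, Finset.mem_univ _, ?_⟩
  have := hpos i
  positivity

lemma exists_inert (ℓ : ℝ[X] →ₗ[ℝ] ℝ) (k : ℕ) (hdet : (hkM ℓ k).det ≠ 0) :
    ∃ a b, a + b = k ∧ 0 < (-1 : ℝ) ^ b * (hkM ℓ k).det ∧ Inert ℓ k a b := by
  have hA : (hkM ℓ k).IsHermitian := by
    ext i j
    simp [hkM, add_comm]
  set lam := hA.eigenvalues with hlam
  have hdetp : (hkM ℓ k).det = ∏ i, lam i := by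
    rw [hA.det_eq_prod_eigenvalues]; simp [hlam]
  have hne : ∀ i, lam i ≠ 0 := by
    intro i hi
    apply hdet
    rw [hdetp]
    exact Finset.prod_eq_zero (Finset.mem_univ i) hi
  let ev : Fin k → (Fin k → ℝ) := fun i => (hA.eigenvectorBasis i).ofLp
  let e : Fin k → ℝ[X] := fun i => tp k (ev i)
  have hev : LinearIndependent ℝ ev := by
    have h1 := hA.eigenvectorBasis.toBasis.linearIndependent
    have h2 := h1.map' (WithLp.linearEquiv 2 ℝ (Fin k → ℝ)).toLinearMap (LinearEquiv.ker _)
    have h3 : ev = (WithLp.linearEquiv 2 ℝ (Fin k → ℝ)).toLinearMap ∘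
        hA.eigenvectorBasis.toBasis := by
      ext i j
      simp [ev]
    rw [h3]
    exact h2
  have hli : LinearIndependent ℝ e := hev.map' (tp k) (LinearMap.ker_eq_bot.mpr (tp_inj k))
  have he : ∀ i j, ℓ (e i * e j) = if i = j then lam i else 0 := by
    intro i j
    rw [tp_form, hA.mulVec_eigenvectorBasis, dotProduct_smul]
    have h3 := (orthonormal_iff_ite.mp hA.eigenvectorBasis.orthonormal) j i
    rw [EuclideanSpace.inner_eq_star_dotProduct] at h3
    simp only [star_trivial] at h3
    rw [h3]
    by_cases hij : i = j
    · subst hij; simp [hlam]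
    · simp [hij, Ne.symm hij]
  let p1 : Fin k → Prop := fun i => 0 < lam i
  have hcard : Fintype.card {i // 0 < lam i} + Fintype.card {i // lam i < 0} = k := by
    have := Fintype.card_subtype_compl (fun i => 0 < lam i)
    have h4 : Fintype.card {i // lam i < 0} = Fintype.card {i // ¬ 0 < lam i} := by
      apply Fintype.card_congr
      apply Equiv.subtypeEquivRight
      intro i
      constructor
      · intro h; exact not_lt.mpr h.le
      · intro h; exact lt_of_le_of_ne (not_lt.mp h) (hne i)
    have h5 := Fintype.card_subtype_le (fun i => 0 < lam i)
    rw [h4, this]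
    simp only [Fintype.card_fin] at *
    omega
  refine ⟨Fintype.card {i // 0 < lam i}, Fintype.card {i // lam i < 0}, hcard, ?_, ?_⟩
  · rw [hdetp]
    have : (-1 : ℝ) ^ (Fintype.card {i // lam i < 0}) = ∏ i, if lam i < 0 then (-1 : ℝ) else 1 := by
      rw [Finset.prod_ite]
      simp [Fintype.card_subtype]
    rw [this, ← Finset.prod_mul_distrib]
    refine Finset.prod_pos fun i _ => ?_
    split_ifs with h
    · linarith
    · have := lt_of_le_of_ne (not_lt.mp h) (hne i).symm
      linarith
  · refine ⟨Submodule.span ℝ (Set.range fun i : {i // 0 < lam i} => e i),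
      Submodule.span ℝ (Set.range fun i : {i // lam i < 0} => e i), ?_, ?_, ?_, ?_, ?_, ?_⟩
    · rw [Submodule.span_le]
      rintro _ ⟨i, rfl⟩
      exact tp_mem _ _
    · rw [Submodule.span_le]
      rintro _ ⟨i, rfl⟩
      exact tp_mem _ _
    · exact finrank_span_eq_card (hli.comp _ Subtype.val_injective)
    · exact finrank_span_eq_card (hli.comp _ Subtype.val_injective)
    · exact posdef_span ℓ _ (fun i => lam i) (by intro i j; simp [he, Subtype.ext_iff]) (fun i => i.2)
    · intro p hp h0
      have := posdef_span (-ℓ) (fun i : {i // lam i < 0} => e i) (fun i => - lam i)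
        (by
          intro i j
          simp only [LinearMap.neg_apply, he, Subtype.ext_iff]
          split_ifs <;> simp)
        (fun i => by have := i.2; linarith) p hp h0
      simpa using this

/-! ### The Frobenius step -/

lemma finrank_degreeLT' (k : ℕ) : Module.finrank ℝ (degreeLT ℝ k) = k := by
  rw [(degreeLTEquiv ℝ k).finrank_eq]; simp

instance finite_degreeLT' (k : ℕ) : FiniteDimensional ℝ (degreeLT ℝ k) :=
  (degreeLTEquiv ℝ k).symm.finiteDimensional

lemma Inert.neg {ℓ : ℝ[X] →ₗ[ℝ] ℝ} {k a b : ℕ} (h : Inert ℓ k a b) : Inert (-ℓ) k b a := by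
  obtain ⟨P, N, h1, h2, h3, h4, h5, h6⟩ := h
  exact ⟨N, P, h2, h1, h4, h3, fun p hp h0 => by simpa using h6 p hp h0,
    fun p hp h0 => by simpa using h5 p hp h0⟩

lemma Inert.bound {ℓ : ℝ[X] →ₗ[ℝ] ℝ} {k a b : ℕ} (h : Inert ℓ k a b) (hab : a + b = k)
    (S : Submodule ℝ ℝ[X]) (hS : S ≤ degreeLT ℝ k) (hneg : ∀ p ∈ S, ℓ (p * p) ≤ 0) :
    Module.finrank ℝ S ≤ b := by
  obtain ⟨P, N, h1, h2, h3, h4, h5, h6⟩ := h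
  have : FiniteDimensional ℝ S := Submodule.finiteDimensional_of_le hS
  have : FiniteDimensional ℝ P := Submodule.finiteDimensional_of_le h1
  have hd : S ⊓ P = ⊥ := by
    rw [eq_bot_iff]
    rintro x ⟨hx1, hx2⟩
    by_contra h0
    exact absurd (h5 x hx2 h0) (not_lt.mpr (hneg x hx1))
  have h7 := Submodule.finrank_sup_add_finrank_inf_eq S P
  rw [hd, finrank_bot, h3] at h7
  have h8 := Submodule.finrank_mono (sup_le hS h1)
  rw [finrank_degreeLT'] at h8
  omega

lemma nondeg_iff (ℓ : ℝ[X] →ₗ[ℝ] ℝ) (k : ℕ) :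
    (hkM ℓ k).det ≠ 0 ↔
      ∀ u ∈ degreeLT ℝ k, (∀ v ∈ degreeLT ℝ k, ℓ (v * u) = 0) → u = 0 := by
  rw [Ne, ← Matrix.exists_mulVec_eq_zero_iff]
  constructor
  · intro h u hu hv
    by_contra h0
    apply h
    refine ⟨fun i => u.coeff i, ?_, ?_⟩
    · intro h1
      apply h0
      rw [← tp_surj k u hu, h1, map_zero]
    · have : ∀ w : Fin k → ℝ, w ⬝ᵥ (hkM ℓ k *ᵥ fun i => u.coeff i) = 0 := by
        intro w
        rw [← tp_form, tp_surj k u hu]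
        exact hv _ (tp_mem k w)
      exact dotProduct_eq_zero _ (fun w => by rw [dotProduct_comm]; exact this w)
  · rintro h ⟨w, hw0, hw⟩
    apply hw0
    apply tp_inj k
    rw [map_zero]
    apply h _ (tp_mem k w)
    intro v hv
    rw [← tp_surj k v hv, tp_form, hw, dotProduct_zero]

lemma exists_orth (ℓ : ℝ[X] →ₗ[ℝ] ℝ) (p : ℕ) (h : (hkM ℓ p).det ≠ 0) :
    ∃ P : ℝ[X], P.Monic ∧ P.natDegree = p ∧ ∀ m < p, ℓ (P * X ^ m) = 0 := by
  let y : Fin p → ℝ := fun i => - ℓ (X ^ (p + (i : ℕ)))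
  let w := (hkM ℓ p)⁻¹ *ᵥ y
  have hw : hkM ℓ p *ᵥ w = y := by
    rw [Matrix.mulVec_mulVec, Matrix.mul_nonsing_inv _ (isUnit_iff_ne_zero.mpr h), Matrix.one_mulVec]
  have hdeg : (tp p w).degree < p := by
    have := tp_mem p w
    rwa [mem_degreeLT] at this
  refine ⟨X ^ p + tp p w, monic_X_pow_add hdeg, ?_, ?_⟩
  · apply natDegree_eq_of_degree_eq_some
    rw [degree_add_eq_left_of_degree_lt] <;> simp [hdeg]
  · intro m hm
    have h1 : (X : ℝ[X]) ^ m = tp p (Pi.single ⟨m, hm⟩ 1) := by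
      simp [tp_apply, Pi.single_apply]
    rw [add_mul, map_add, mul_comm (tp p w)]
    nth_rewrite 2 [h1]
    rw [tp_form, hw, single_dotProduct, ← pow_add]
    simp [y]

lemma orth_coeff (ℓ : ℝ[X] →ₗ[ℝ] ℝ) (P : ℝ[X]) (M : ℕ) (h : ∀ m < M, ℓ (P * X ^ m) = 0)
    (q : ℝ[X]) (hq : q.natDegree < M + 1) : ℓ (P * q) = q.coeff M * ℓ (P * X ^ M) := by
  conv_lhs => rw [q.as_sum_range' (M + 1) hq]
  rw [Finset.mul_sum, map_sum, Finset.sum_range_succ, Finset.sum_eq_zero]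
  · rw [← C_mul_X_pow_eq_monomial, ← smul_eq_C_mul, mul_smul_comm, map_smul, smul_eq_mul, zero_add]
  · intro i hi
    rw [← C_mul_X_pow_eq_monomial, ← smul_eq_C_mul, mul_smul_comm, map_smul,
      h i (Finset.mem_range.mp hi), smul_zero]

lemma orth_zero (ℓ : ℝ[X] →ₗ[ℝ] ℝ) (P : ℝ[X]) (M : ℕ) (h : ∀ m < M, ℓ (P * X ^ m) = 0)
    (q : ℝ[X]) (hq : q.natDegree < M) : ℓ (P * q) = 0 := by
  rw [orth_coeff ℓ P M h q (by omega), coeff_eq_zero_of_natDegree_lt hq, zero_mul]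

lemma mem_degreeLT_of_natDegree {k : ℕ} {q : ℝ[X]} (h : q.natDegree < k) : q ∈ degreeLT ℝ k := by
  rw [mem_degreeLT]
  exact lt_of_le_of_lt degree_le_natDegree (by exact_mod_cast h)

lemma natDegree_of_mem_degreeLT {k : ℕ} {q : ℝ[X]} (h : q ∈ degreeLT ℝ k) (h0 : q ≠ 0) :
    q.natDegree < k := by
  rw [mem_degreeLT] at h
  exact (natDegree_lt_iff_degree_lt h0).mpr h

lemma orth_extend (ℓ : ℝ[X] →ₗ[ℝ] ℝ) (p d : ℕ) (h : (hkM ℓ p).det ≠ 0)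
    (hz : ∀ j, 1 ≤ j → j ≤ d → (hkM ℓ (p + j)).det = 0) (P : ℝ[X]) (hP : P.Monic)
    (hPd : P.natDegree = p) (hPo : ∀ m < p, ℓ (P * X ^ m) = 0) :
    ∀ m < p + d, ℓ (P * X ^ m) = 0 := by
  intro m
  induction m using Nat.strong_induction_on with
  | _ m ih =>
    intro hm
    by_cases hmp : m < p
    · exact hPo m hmp
    obtain ⟨e, rfl⟩ := Nat.exists_eq_add_of_le (not_lt.mp hmp)
    by_contra hc
    have hlow : ∀ m < p + e, ℓ (P * X ^ m) = 0 := fun m hm' => ih m hm' (by omega)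
    have hdz := hz (e + 1) (by omega) (by omega)
    refine absurd hdz ((nondeg_iff ℓ _).mpr ?_)
    intro u hu huv
    by_contra hu0
    have hud := natDegree_of_mem_degreeLT hu hu0
    by_cases hup : u.natDegree < p
    · apply hu0
      refine (nondeg_iff ℓ p).mp h u (mem_degreeLT_of_natDegree hup) ?_
      intro v hv
      exact huv v (degreeLT_mono (by omega) hv)
    · obtain ⟨i, hi⟩ := Nat.exists_eq_add_of_le (not_lt.mp hup)
      have h1 := huv (P * X ^ (e - i)) (mem_degreeLT_of_natDegree (by
        rw [hP.natDegree_mul (monic_X_pow _), natDegree_X_pow]; omega))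
      have hdeg : (X ^ (e - i) * u).natDegree = p + e := by
        rw [(monic_X_pow _).natDegree_mul' hu0, natDegree_X_pow]; omega
      rw [mul_assoc, orth_coeff ℓ P (p + e) hlow _ (by omega)] at h1
      have h2 : (X ^ (e - i) * u).coeff (p + e) ≠ 0 := by
        rw [← hdeg]
        apply leadingCoeff_ne_zero.mpr
        exact mul_ne_zero (pow_ne_zero _ X_ne_zero) hu0
      exact (mul_ne_zero h2 hc) h1

lemma frob_half (ℓ : ℝ[X] →ₗ[ℝ] ℝ) (p d a b a' b' : ℕ) (h : (hkM ℓ p).det ≠ 0)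
    (hz : ∀ j, 1 ≤ j → j ≤ d → (hkM ℓ (p + j)).det = 0)
    (hI : Inert ℓ p a b) (hI' : Inert ℓ (p + d + 1) a' b') (hab' : a' + b' = p + d + 1) :
    b + (d + 1) / 2 ≤ b' := by
  obtain ⟨Q, hQ, hQd, hQo⟩ := exists_orth ℓ p h
  have hQo' := orth_extend ℓ p d h hz Q hQ hQd hQo
  obtain ⟨P, N, h1, h2, h3, h4, h5, h6⟩ := hI
  set m := (d + 1) / 2 with hm
  let mu : ℝ[X] →ₗ[ℝ] ℝ[X] := LinearMap.mulLeft ℝ Q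
  have hmu : Function.Injective mu := by
    intro x y hxy
    exact mul_left_cancel₀ hQ.ne_zero hxy
  let I := (degreeLT ℝ m).map mu
  have hIfr : Module.finrank ℝ I = m := by
    rw [(Submodule.equivMapOfInjective mu hmu (degreeLT ℝ m)).symm.finrank_eq, finrank_degreeLT']
  have hdegI : ∀ g ∈ degreeLT ℝ m, g ≠ 0 →
      (Q * g).natDegree = p + g.natDegree ∧ g.natDegree < m := by
    intro g hg hg0
    exact ⟨by rw [hQ.natDegree_mul' hg0, hQd], natDegree_of_mem_degreeLT hg hg0⟩
  have hIle : I ≤ degreeLT ℝ (p + d + 1) := by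
    rintro _ ⟨g, hg, rfl⟩
    by_cases hg0 : g = 0
    · subst hg0; simp
    · obtain ⟨e1, e2⟩ := hdegI g hg hg0
      apply mem_degreeLT_of_natDegree
      change (Q * g).natDegree < _
      omega
  have : FiniteDimensional ℝ N := Submodule.finiteDimensional_of_le h2
  have : FiniteDimensional ℝ I := Submodule.finiteDimensional_of_le hIle
  have hdis : N ⊓ I = ⊥ := by
    rw [eq_bot_iff]
    rintro x ⟨hx1, ⟨g, hg, rfl⟩⟩
    by_cases hg0 : g = 0
    · subst hg0; simp
    · obtain ⟨e1, e2⟩ := hdegI g hg hg0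
      have h7 : mu g ≠ 0 := mul_ne_zero hQ.ne_zero hg0
      have h8 := natDegree_of_mem_degreeLT (h2 hx1) h7
      change (Q * g).natDegree < _ at h8
      omega
  have hsum := Submodule.finrank_sup_add_finrank_inf_eq N I
  rw [hdis, finrank_bot, h4, hIfr] at hsum
  have hle : N ⊔ I ≤ degreeLT ℝ (p + d + 1) :=
    sup_le (h2.trans (degreeLT_mono (by omega))) hIle
  have := hI'.bound hab' (N ⊔ I) hle ?_
  · omega
  intro x hx
  obtain ⟨y, hy, _, ⟨g, hg, rfl⟩, rfl⟩ := Submodule.mem_sup.mp hx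
  change ℓ ((y + Q * g) * (y + Q * g)) ≤ 0
  have hyy : ℓ (y * y) ≤ 0 := by
    by_cases hy0 : y = 0
    · simp [hy0]
    · exact (h6 y hy hy0).le
  by_cases hg0 : g = 0
  · simpa [hg0] using hyy
  obtain ⟨e1, e2⟩ := hdegI g hg hg0
  have e3 : ℓ (Q * (g * y)) = 0 := by
    by_cases hy0 : y = 0
    · simp [hy0]
    · apply orth_zero ℓ Q (p + d) hQo'
      have := natDegree_of_mem_degreeLT (h2 hy) hy0
      have := natDegree_mul_le (p := g) (q := y)
      omega
  have e4 : ℓ (Q * (g * (Q * g))) = 0 := by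
    apply orth_zero ℓ Q (p + d) hQo'
    have := natDegree_mul_le (p := g) (q := Q * g)
    omega
  have e5 : (y + Q * g) * (y + Q * g) = y * y + Q * (g * y) + Q * (g * y) + Q * (g * (Q * g)) := by
    ring
  rw [e5]
  simp only [map_add, e3, e4]
  linarith

lemma hkM_neg_det (ℓ : ℝ[X] →ₗ[ℝ] ℝ) (k : ℕ) :
    (hkM (-ℓ) k).det = (-1) ^ k * (hkM ℓ k).det := by
  have : hkM (-ℓ) k = - hkM ℓ k := by
    ext i j; simp [hkM]
  rw [this, Matrix.det_neg]; simp

/-- The negative index jumps by `(d+1)/2`, or possibly one more when `d` is even. -/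
lemma frob_step (ℓ : ℝ[X] →ₗ[ℝ] ℝ) (p d a b a' b' : ℕ) (h : (hkM ℓ p).det ≠ 0)
    (hz : ∀ j, 1 ≤ j → j ≤ d → (hkM ℓ (p + j)).det = 0) (hab : a + b = p)
    (hI : Inert ℓ p a b) (hI' : Inert ℓ (p + d + 1) a' b') (hab' : a' + b' = p + d + 1) :
    b + (d + 1) / 2 ≤ b' ∧ b' + (d + 1) / 2 ≤ b + d + 1 := by
  have h1 := frob_half ℓ p d a b a' b' h hz hI hI' hab'
  have h2 := frob_half (-ℓ) p d b a b' a' (by rw [hkM_neg_det]; simp [h])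
    (by intro j h1 h2; rw [hkM_neg_det, hz j h1 h2, mul_zero]) hI.neg hI'.neg (by omega)
  omega

/-! ### Determinant identities -/

lemma det_interleave (k : ℕ) : ∀ (m N M : ℕ) (_ : N = 2 * k + m) (_ : M = k + m) (v : ℕ → ℕ → ℝ),
    Matrix.det (Matrix.of fun r c : Fin N =>
      if (r : ℕ) < 2 * k then
        (if (r : ℕ) % 2 = 0 then (if (c : ℕ) = (r : ℕ) / 2 then (1 : ℝ) else 0)
          else v ((r : ℕ) / 2) c)
      else v ((r : ℕ) - k) c) =
    Matrix.det (Matrix.of fun i c : Fin M =>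
      v (if (i : ℕ) < k then k - 1 - i else i) ((c : ℕ) + k)) := by
  induction k with
  | zero =>
    intro m N M hN hM v
    have : N = M := by omega
    subst this
    simp
  | succ k ih =>
    intro m N M hN hM v
    obtain ⟨N', rfl⟩ : ∃ N', N = N' + 1 := ⟨2 * k + 1 + m, by omega⟩
    have h1 := ih (m + 1) N' M (by omega) (by omega)
      (fun i c => (if i < k then v (i + 1) (c + 1) else if i = k then v 0 (c + 1) else v i (c + 1)))
    rw [Matrix.det_succ_row_zero, Fin.sum_univ_succ, Finset.sum_eq_zero]
    · have hlt : 2 * k < N' := by omega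
      have hperm := Matrix.det_permute (Fin.cycleRange (⟨2 * k, hlt⟩ : Fin N'))
        (Matrix.submatrix (Matrix.of fun r c : Fin (N' + 1) =>
          if (r : ℕ) < 2 * (k + 1) then
            (if (r : ℕ) % 2 = 0 then (if (c : ℕ) = (r : ℕ) / 2 then (1 : ℝ) else 0)
              else v ((r : ℕ) / 2) c)
          else v ((r : ℕ) - (k + 1)) c) Fin.succ (Fin.succAbove 0))
      have hsgn : Equiv.Perm.sign (Fin.cycleRange (⟨2 * k, hlt⟩ : Fin N')) = 1 := by
        obtain ⟨N'', rfl⟩ : ∃ N'', N' = N'' + 1 := ⟨2 * k + m, by omega⟩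
        rw [Fin.sign_cycleRange]
        simp
      rw [hsgn] at hperm
      simp only [Units.val_one, Int.cast_one, one_mul] at hperm
      rw [← hperm]
      have e1 : Matrix.det (Matrix.of fun i c : Fin M =>
          v (if (i : ℕ) < k + 1 then k + 1 - 1 - i else i) ((c : ℕ) + (k + 1))) =
          Matrix.det (Matrix.of fun i c : Fin M =>
            (fun i c => (if i < k then v (i + 1) (c + 1) else if i = k then v 0 (c + 1)
              else v i (c + 1))) (if (i : ℕ) < k then k - 1 - i else i) ((c : ℕ) + k)) := by
        congr 1
        ext i c
        simp only [Matrix.of_apply]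
        rcases lt_trichotomy (i : ℕ) k with h | h | h
        · rw [if_pos (by omega), if_pos h, if_pos (by omega)]
          congr 1; omega
        · simp [h, add_assoc]
        · have h1 : ¬ (i : ℕ) < k + 1 := by omega
          have h2 : ¬ (i : ℕ) < k := by omega
          have h3 : ¬ (i : ℕ) = k := by omega
          simp only [h1, h2, h3, if_false]
          congr 1
      rw [e1, ← h1]
      simp only [Matrix.of_apply, Fin.val_zero, pow_zero, add_zero]
      rw [if_pos (by omega), if_pos (by simp), if_pos (by simp), one_mul, one_mul]
      congr 1
      ext r c
      simp only [Matrix.of_apply, Matrix.submatrix_apply, id, Fin.succAbove_zero, Fin.val_succ]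
      rcases lt_trichotomy (r : ℕ) (2 * k) with h | h | h
      · have hr : ((Fin.cycleRange (⟨2 * k, hlt⟩ : Fin N')) r : ℕ) = r + 1 :=
          Fin.coe_cycleRange_of_lt (by rw [Fin.lt_def]; exact h)
        simp only [hr]
        rw [if_pos h, if_pos (by omega)]
        by_cases h2 : (r : ℕ) % 2 = 0
        · rw [if_pos h2, if_pos (by omega)]
          congr 1
          rw [eq_iff_iff]; omega
        · rw [if_neg h2, if_neg (by omega), if_pos (by omega)]
          congr 1; omega
      · have hr : ((Fin.cycleRange (⟨2 * k, hlt⟩ : Fin N')) r : ℕ) = 0 := by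
          have : r = ⟨2 * k, hlt⟩ := Fin.ext h
          rw [this]
          obtain ⟨N'', rfl⟩ : ∃ N'', N' = N'' + 1 := ⟨2 * k + m, by omega⟩
          rw [Fin.cycleRange_self]; rfl
        simp only [hr]
        rw [if_pos (by omega), if_neg (by omega), if_neg (by omega), if_neg (by omega),
          if_pos (by omega)]
      · have hr : ((Fin.cycleRange (⟨2 * k, hlt⟩ : Fin N')) r : ℕ) = r := by
          rw [Fin.cycleRange_of_gt (by rw [Fin.lt_def]; exact h)]
        simp only [hr]
        rw [if_neg (by omega), if_neg (by omega), if_neg (by omega), if_neg (by omega)]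
        congr 1; omega
    · intro i _
      simp

lemma discD_eq (n : ℕ) (a s : ℕ → ℝ)
    (hS : ∀ i, (if i + 1 ≤ n then ((n - i : ℕ) : ℝ) * a i else 0) =
      ∑ j ∈ Finset.range (i + 1), s j * (if i - j ≤ n then a (i - j) else 0)) (k : ℕ) :
    discD n a k = a 0 ^ (2 * k) *
      Matrix.det (Matrix.of fun i j : Fin k => s ((i : ℕ) + (j : ℕ))) := by
  let T : Matrix (Fin (2 * k)) (Fin (2 * k)) ℝ := Matrix.of fun t c =>
    if (t : ℕ) ≤ c then (if (c : ℕ) - t ≤ n then a (c - t) else 0) else 0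
  let v : ℕ → ℕ → ℝ := fun j c => if j + 1 ≤ c then s (c - (j + 1)) else 0
  let Nm : Matrix (Fin (2 * k)) (Fin (2 * k)) ℝ := Matrix.of fun r c =>
      if (r : ℕ) < 2 * k then
        (if (r : ℕ) % 2 = 0 then (if (c : ℕ) = (r : ℕ) / 2 then (1 : ℝ) else 0)
          else v ((r : ℕ) / 2) c)
      else v ((r : ℕ) - k) c
  have hT : T.det = a 0 ^ (2 * k) := by
    rw [Matrix.det_of_isUpperTriangular]
    · simp [T]
    · intro i j hij
      simp only [id] at hij
      simp only [T, Matrix.of_apply]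
      rw [if_neg]
      exact not_le.mpr hij
  have hN : Nm.det = Matrix.det (Matrix.of fun i j : Fin k => s ((i : ℕ) + (j : ℕ))) := by
    rw [det_interleave k 0 (2 * k) k (by omega) (by omega) v]
    congr 1
    ext i c
    simp only [Matrix.of_apply, v]
    have := i.2
    rw [if_pos i.2, if_pos (by omega)]
    congr 1
    omega
  rw [← hT, ← hN, mul_comm, ← Matrix.det_mul]
  unfold discD discMinor
  congr 1
  ext r c
  have hr := r.2
  have hc := c.2
  rw [Matrix.mul_apply]
  simp only [Matrix.of_apply, Nm, T]
  simp only [hr, if_true]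
  unfold discEntry
  rw [Finset.sum_fin_eq_sum_range]
  by_cases h2 : (r : ℕ) % 2 = 0
  · simp only [h2, if_true]
    rw [Finset.sum_eq_single ((r : ℕ) / 2)]
    · rw [dif_pos (by omega)]
      simp only [if_true, one_mul]
      by_cases h3 : (r : ℕ) / 2 ≤ c
      · rw [if_pos h3]
        congr 1
        rw [eq_iff_iff]; omega
      · rw [if_neg h3, if_neg (by tauto)]
    · intro b _ hb
      split_ifs <;> simp
    · intro h; simp at h; omega
  · simp only [h2, if_false]
    have hd : ((r : ℕ) + 1) / 2 = (r : ℕ) / 2 + 1 := by omega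
    rw [hd]
    set ρ := (r : ℕ) / 2 + 1 with hρ
    by_cases h3 : ρ ≤ c
    · have h4 := hS (c - ρ)
      have h5 : (if ρ ≤ (c : ℕ) ∧ (c : ℕ) + 1 ≤ ρ + n then ((n - (c - ρ) : ℕ) : ℝ) * a (c - ρ) else 0)
         = (if c - ρ + 1 ≤ n then ((n - (c - ρ) : ℕ) : ℝ) * a (c - ρ) else 0) := by
        congr 1
        rw [eq_iff_iff]; omega
      rw [h5, h4]
      symm
      rw [← Finset.sum_subset (s₁ := Finset.Icc ρ c)]
      · refine Finset.sum_nbij' (fun t => t - ρ) (fun j => j + ρ) ?_ ?_ ?_ ?_ ?_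
        · intro t ht; simp at ht ⊢; omega
        · intro t ht; simp at ht ⊢; omega
        · intro t ht; simp at ht ⊢; omega
        · intro t ht; simp at ht ⊢
        · intro t ht
          simp only [Finset.mem_Icc] at ht
          rw [dif_pos (by omega)]
          simp only [v]
          rw [if_pos (by omega), if_pos ht.2]
          have : (c : ℕ) - ρ - (t - ρ) = c - t := by omega
          rw [this]
      · intro t ht; simp at ht ⊢; omega
      · intro t ht ht2
        simp only [Finset.mem_range, Finset.mem_Icc, not_and, not_le] at ht ht2
        rw [dif_pos ht]
        simp only [v]
        by_cases h6 : ρ ≤ t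
        · rw [if_neg (not_le.mpr (ht2 h6)), mul_zero]
        · rw [if_neg h6, zero_mul]
    · rw [if_neg (by tauto)]
      symm
      apply Finset.sum_eq_zero
      intro t ht
      rw [Finset.mem_range] at ht
      rw [dif_pos ht]
      simp only [v]
      by_cases h6 : ρ ≤ t
      · rw [if_neg (by omega : ¬ t ≤ (c : ℕ)), mul_zero]
      · rw [if_neg h6, zero_mul]

/-! ### Newton sums -/

/-- The real part of the sum of values over a multiset of complex numbers. -/
noncomputable def ellR (R : Multiset ℂ) : ℝ[X] →ₗ[ℝ] ℝ where
  toFun p := (R.map fun z => (aeval z p).re).sum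
  map_add' p q := by simp [Multiset.sum_map_add]
  map_smul' c p := by simp [Multiset.sum_map_mul_left]

lemma ellR_apply (R : Multiset ℂ) (p : ℝ[X]) :
    ellR R p = (R.map fun z => (aeval z p).re).sum := rfl

/-- The complex roots. -/
noncomputable def cR (f : ℝ[X]) : Multiset ℂ := (f.map (algebraMap ℝ ℂ)).roots

lemma cR_splits (f : ℝ[X]) : (f.map (algebraMap ℝ ℂ)).Splits := IsAlgClosed.splits _

lemma cR_conj (f : ℝ[X]) : (cR f).map (starRingEnd ℂ) = cR f := by
  unfold cR
  rw [← (cR_splits f).roots_map (starRingEnd ℂ), Polynomial.map_map]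
  congr 2
  ext x
  simp

lemma deriv_eq_sum (f : ℂ[X]) (hf : f.Splits) :
    derivative f = (f.roots.map fun z => f /ₘ (X - C z)).sum := by
  classical
  conv_lhs => rw [hf.eq_prod_roots]
  rw [derivative_C_mul, derivative_prod, ← AddMonoidHom.coe_mulLeft,
    (AddMonoidHom.mulLeft (C f.leadingCoeff)).map_multiset_sum]
  rw [Multiset.map_map]
  congr 1
  refine Multiset.map_congr rfl fun z hz => ?_
  simp only [Function.comp_apply, AddMonoidHom.coe_mulLeft, derivative_X_sub_C, mul_one]
  symm
  have h1 : f = (X - C z) * (C f.leadingCoeff * ((f.roots.erase z).map (fun a => X - C a)).prod) := by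
    conv_lhs => rw [hf.eq_prod_roots, ← Multiset.cons_erase hz]
    rw [Multiset.map_cons, Multiset.prod_cons]
    ring
  conv_lhs => rw [h1]
  exact mul_divByMonic_cancel_left _ (monic_X_sub_C z)

lemma newtonC (n : ℕ) (f : ℂ[X]) (hdeg : f.natDegree = n) (hf : f.Splits) (i : ℕ) :
    (if i + 1 ≤ n then ((n - i : ℕ) : ℂ) * f.coeff (n - i) else 0) =
      ∑ j ∈ Finset.range (i + 1), (f.roots.map fun z => z ^ j).sum *
        (if i - j ≤ n then f.coeff (n - (i - j)) else 0) := by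
  have hr : ∑ j ∈ Finset.range (i + 1), (f.roots.map fun z => z ^ j).sum *
        (if i - j ≤ n then f.coeff (n - (i - j)) else 0) =
      (f.roots.map fun z => ∑ j ∈ Finset.range (i + 1), z ^ j *
        (if i - j ≤ n then f.coeff (n - (i - j)) else 0)).sum := by
    rw [Multiset.sum_map_sum]
    exact Finset.sum_congr rfl fun j _ => (Multiset.sum_map_mul_right).symm
  rw [hr]
  split_ifs with hi
  · have h1 := congrArg (lcoeff ℂ (n - i - 1)) (deriv_eq_sum f hf)
    rw [map_multiset_sum, lcoeff_apply, coeff_derivative, Multiset.map_map] at h1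
    have h2 : n - i - 1 + 1 = n - i := by omega
    have h3 : (((n - i - 1 : ℕ) : ℂ) + 1) = ((n - i : ℕ) : ℂ) := by
      rw [← h2]; push_cast; rfl
    rw [h2, h3] at h1
    rw [mul_comm, h1]
    congr 1
    refine Multiset.map_congr rfl fun z hz => ?_
    simp only [Function.comp_apply, lcoeff_apply]
    rw [coeff_divByMonic_X_sub_C, h2, hdeg]
    refine Finset.sum_nbij' (fun t => t - (n - i)) (fun j => j + (n - i)) ?_ ?_ ?_ ?_ ?_
    · intro t ht; simp at ht ⊢; omega
    · intro t ht; simp at ht ⊢; omega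
    · intro t ht; simp at ht ⊢; omega
    · intro t ht; simp at ht ⊢
    · intro t ht
      simp only [Finset.mem_Icc] at ht
      rw [if_pos (by omega)]
      congr 2
      omega
  · symm
    apply Multiset.sum_eq_zero
    intro x hx
    obtain ⟨z, hz, rfl⟩ := Multiset.mem_map.mp hx
    have hz0 : f.eval z = 0 := by
      have := isRoot_of_mem_roots hz
      exact this
    rw [eval_eq_sum_range, hdeg] at hz0
    have : ∑ j ∈ Finset.range (i + 1), z ^ j * (if i - j ≤ n then f.coeff (n - (i - j)) else 0) =
        z ^ (i - n) * ∑ t ∈ Finset.range (n + 1), f.coeff t * z ^ t := by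
      rw [Finset.mul_sum, ← Finset.sum_subset (s₁ := Finset.Icc (i - n) i)]
      · refine Finset.sum_nbij' (fun j => j - (i - n)) (fun t => t + (i - n)) ?_ ?_ ?_ ?_ ?_
        · intro t ht; simp at ht ⊢; omega
        · intro t ht; simp at ht ⊢; omega
        · intro t ht; simp at ht ⊢; omega
        · intro t ht; simp at ht ⊢
        · intro j hj
          simp only [Finset.mem_Icc] at hj
          rw [if_pos (by omega)]
          have e1 : n - (i - j) = j - (i - n) := by omega
          rw [e1, mul_left_comm, ← pow_add, mul_comm]
          congr 2
          omega
      · intro t ht; simp at ht ⊢; omega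
      · intro t ht ht2
        simp only [Finset.mem_range, Finset.mem_Icc, not_and, not_le] at ht ht2
        rw [if_neg (by omega), mul_zero]
    rw [this, hz0, mul_zero]

lemma ellR_coe (f p : ℝ[X]) : ((ellR (cR f) p : ℝ) : ℂ) = ((cR f).map fun z => aeval z p).sum := by
  have h0 : ellR (cR f) p = (((cR f).map fun z => aeval z p).sum).re := by
    have h1 := map_multiset_sum Complex.reLm ((cR f).map fun z => aeval z p)
    rw [Multiset.map_map] at h1
    exact h1.symm
  rw [h0]
  refine Complex.conj_eq_iff_re.mp ?_
  rw [map_multiset_sum, Multiset.map_map]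
  conv_rhs => rw [← cR_conj f, Multiset.map_map]
  congr 1
  refine Multiset.map_congr rfl fun z _ => ?_
  simp only [Function.comp_apply]
  exact (aeval_conj p z).symm

lemma newtonR (n : ℕ) (f : ℝ[X]) (hdeg : f.natDegree = n) (i : ℕ) :
    (if i + 1 ≤ n then ((n - i : ℕ) : ℝ) * coeffSeq n f i else 0) =
      ∑ j ∈ Finset.range (i + 1), ellR (cR f) (X ^ j) *
        (if i - j ≤ n then coeffSeq n f (i - j) else 0) := by
  have h := newtonC n (f.map (algebraMap ℝ ℂ)) (by simp [hdeg]) (cR_splits f) i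
  apply Complex.ofReal_injective
  rw [Complex.ofReal_sum]
  simp only [Complex.ofReal_mul, ellR_coe]
  convert h using 1
  · split_ifs <;> simp [coeffSeq]
  · refine Finset.sum_congr rfl fun j _ => ?_
    congr 1
    · simp [cR]
    · split_ifs <;> simp [coeffSeq]

lemma discD_hankel (n : ℕ) (f : ℝ[X]) (hdeg : f.natDegree = n) (k : ℕ) :
    discD n (coeffSeq n f) k = f.coeff n ^ (2 * k) * (hkM (ellR (cR f)) k).det := by
  rw [discD_eq n (coeffSeq n f) (fun j => ellR (cR f) (X ^ j)) (newtonR n f hdeg) k]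
  simp [coeffSeq, hkM]

/-- Rectangular Vandermonde factorization. -/
lemma hankel_factor (f : ℝ[X]) (k r : ℕ) (v : Fin r → ℂ) (hv : Function.Injective v)
    (hv2 : Finset.univ.image v = (cR f).toFinset) :
    (hkM (ellR (cR f)) k).map (algebraMap ℝ ℂ) =
      (Matrix.of fun (i : Fin r) (j : Fin k) => v i ^ (j : ℕ))ᵀ *
      Matrix.diagonal (fun i => ((cR f).count (v i) : ℂ)) *
      (Matrix.of fun (i : Fin r) (j : Fin k) => v i ^ (j : ℕ)) := by
  ext i j
  rw [Matrix.mul_apply]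
  simp only [Matrix.map_apply, hkM, Matrix.of_apply, Complex.coe_algebraMap, ellR_coe,
    Matrix.mul_diagonal, Matrix.transpose_apply]
  rw [Finset.sum_multiset_map_count, ← hv2, Finset.sum_image (fun a _ b _ h => hv h)]
  refine Finset.sum_congr rfl fun t _ => ?_
  simp [pow_add]
  ring

lemma exists_enum (f : ℝ[X]) : ∃ v : Fin (cR f).toFinset.card → ℂ, Function.Injective v ∧
    Finset.univ.image v = (cR f).toFinset := by
  refine ⟨fun i => ((cR f).toFinset.equivFin.symm i : ℂ), ?_, ?_⟩
  · intro a b h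
    exact (cR f).toFinset.equivFin.symm.injective (Subtype.ext h)
  · ext z
    simp only [Finset.mem_image, Finset.mem_univ, true_and]
    constructor
    · rintro ⟨a, rfl⟩
      exact Subtype.prop _
    · intro h
      exact ⟨(cR f).toFinset.equivFin ⟨z, h⟩, by simp⟩

lemma hankel_det_zero (f : ℝ[X]) (k : ℕ) (hk : (cR f).toFinset.card < k) :
    (hkM (ellR (cR f)) k).det = 0 := by
  obtain ⟨v, hv, hv2⟩ := exists_enum f
  have h := hankel_factor f k _ v hv hv2
  by_contra h0
  have h1 : ((hkM (ellR (cR f)) k).map (algebraMap ℝ ℂ)).det ≠ 0 := by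
    have := RingHom.map_det (algebraMap ℝ ℂ) (hkM (ellR (cR f)) k)
    rw [RingHom.mapMatrix_apply] at this
    rw [← this]
    simpa using h0
  have h2 := Matrix.rank_of_isUnit _ ((Matrix.isUnit_iff_isUnit_det _).mpr (isUnit_iff_ne_zero.mpr h1))
  rw [h] at h2
  have h3 := Matrix.rank_mul_le_right ((Matrix.of fun (i : Fin (cR f).toFinset.card) (j : Fin k) =>
      v i ^ (j : ℕ))ᵀ * Matrix.diagonal (fun i => ((cR f).count (v i) : ℂ)))
      (Matrix.of fun (i : Fin (cR f).toFinset.card) (j : Fin k) => v i ^ (j : ℕ))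
  have h4 := Matrix.rank_le_card_height
    (Matrix.of fun (i : Fin (cR f).toFinset.card) (j : Fin k) => v i ^ (j : ℕ))
  simp only [Fintype.card_fin] at h2 h4
  omega

lemma hankel_det_ne (f : ℝ[X]) : (hkM (ellR (cR f)) (cR f).toFinset.card).det ≠ 0 := by
  obtain ⟨v, hv, hv2⟩ := exists_enum f
  have h := congrArg Matrix.det (hankel_factor f (cR f).toFinset.card _ v hv hv2)
  have h5 := RingHom.map_det (algebraMap ℝ ℂ) (hkM (ellR (cR f)) (cR f).toFinset.card)
  rw [RingHom.mapMatrix_apply, h, Matrix.det_mul, Matrix.det_mul, Matrix.det_transpose,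
    Matrix.det_diagonal] at h5
  have h6 : Matrix.det (Matrix.of fun (i j : Fin (cR f).toFinset.card) => v i ^ (j : ℕ)) ≠ 0 :=
    Matrix.det_vandermonde_ne_zero_iff.mpr hv
  have h7 : ∏ i, ((cR f).count (v i) : ℂ) ≠ 0 := by
    rw [Finset.prod_ne_zero_iff]
    intro i _
    have : v i ∈ cR f := by
      rw [← Multiset.mem_toFinset, ← hv2]
      exact Finset.mem_image_of_mem _ (Finset.mem_univ i)
    exact_mod_cast (Multiset.count_pos.mpr this).ne'
  intro h0
  rw [h0, map_zero] at h5
  exact (mul_ne_zero (mul_ne_zero h6 h7) h6) h5.symm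

/-! ### Inertia of the trace form and counting of roots -/

lemma mem_cR (f : ℝ[X]) (hf : f ≠ 0) (z : ℂ) : z ∈ cR f ↔ aeval z f = 0 := by
  unfold cR
  rw [mem_roots ((Polynomial.map_ne_zero_iff (algebraMap ℝ ℂ).injective).mpr hf),
    IsRoot.def, eval_map_algebraMap]

lemma conj_mem (f : ℝ[X]) {z : ℂ} (hz : z ∈ (cR f).toFinset) :
    (starRingEnd ℂ) z ∈ (cR f).toFinset := by
  rw [Multiset.mem_toFinset] at hz ⊢
  rw [← cR_conj f]
  exact Multiset.mem_map_of_mem _ hz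

lemma card_neg_eq (f : ℝ[X]) : ((cR f).toFinset.filter fun z => z.im < 0).card =
    ((cR f).toFinset.filter fun z => 0 < z.im).card := by
  refine Finset.card_nbij' (starRingEnd ℂ) (starRingEnd ℂ) ?_ ?_ ?_ ?_
  · intro z hz
    simp only [Finset.coe_filter, Set.mem_ofPred_eq] at hz ⊢
    exact ⟨conj_mem f hz.1, by simpa using hz.2⟩
  · intro z hz
    simp only [Finset.coe_filter, Set.mem_ofPred_eq] at hz ⊢
    exact ⟨conj_mem f hz.1, by simpa using hz.2⟩
  · intro z _; simp
  · intro z _; simp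

lemma card_nonreal (f : ℝ[X]) : ((cR f).toFinset.filter fun z => z.im ≠ 0).card =
    2 * ((cR f).toFinset.filter fun z => 0 < z.im).card := by
  have h : ((cR f).toFinset.filter fun z => z.im ≠ 0) =
      ((cR f).toFinset.filter fun z => z.im < 0) ∪ ((cR f).toFinset.filter fun z => 0 < z.im) := by
    ext z
    simp only [Finset.mem_filter, Finset.mem_union, ne_iff_lt_or_gt]
    tauto
  rw [h, Finset.card_union_of_disjoint, card_neg_eq]
  · ring
  · rw [Finset.disjoint_left]
    intro z h1 h2
    simp only [Finset.mem_filter] at h1 h2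
    linarith [h1.2, h2.2]

lemma card_real (f : ℝ[X]) (hf : f ≠ 0) : ((cR f).toFinset.filter fun z => z.im = 0).card =
    f.roots.toFinset.card := by
  have h : ((cR f).toFinset.filter fun z => z.im = 0) =
      f.roots.toFinset.image (fun x : ℝ => (x : ℂ)) := by
    ext z
    simp only [Finset.mem_filter, Finset.mem_image, Multiset.mem_toFinset, mem_cR f hf,
      mem_roots hf, IsRoot.def]
    have key : ∀ x : ℝ, aeval (x : ℂ) f = ((f.eval x : ℝ) : ℂ) := by
      intro x
      have := aeval_algebraMap_apply ℂ x f
      simpa using this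
    constructor
    · rintro ⟨h1, h2⟩
      have hz : z = ((z.re : ℝ) : ℂ) := Complex.ext rfl (by simpa using h2)
      refine ⟨z.re, ?_, hz.symm⟩
      rw [hz, key] at h1
      exact_mod_cast h1
    · rintro ⟨x, hx, rfl⟩
      exact ⟨by rw [key, hx]; rfl, by simp⟩
  rw [h, Finset.card_image_of_injective _ Complex.ofReal_injective]

lemma card_total (f : ℝ[X]) : (cR f).toFinset.card =
    ((cR f).toFinset.filter fun z => z.im = 0).card +
    2 * ((cR f).toFinset.filter fun z => 0 < z.im).card := by
  rw [← card_nonreal]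
  exact (Finset.card_filter_add_card_filter_not _).symm

lemma card_nonneg (f : ℝ[X]) : ((cR f).toFinset.filter fun z => 0 ≤ z.im).card =
    ((cR f).toFinset.filter fun z => z.im = 0).card +
    ((cR f).toFinset.filter fun z => 0 < z.im).card := by
  rw [← Finset.card_union_of_disjoint]
  · congr 1
    ext z
    simp only [Finset.mem_filter, Finset.mem_union, le_iff_eq_or_lt]
    constructor
    · rintro ⟨h1, h2 | h2⟩
      · exact Or.inl ⟨h1, h2.symm⟩
      · exact Or.inr ⟨h1, h2⟩
    · rintro (⟨h1, h2⟩ | ⟨h1, h2⟩)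
      · exact ⟨h1, Or.inl h2.symm⟩
      · exact ⟨h1, Or.inr h2⟩
  · rw [Finset.disjoint_left]
    intro z h1 h2
    simp only [Finset.mem_filter] at h1 h2
    linarith [h1.2, h2.2]

lemma ell_sq (R : Multiset ℂ) (p : ℝ[X]) : ellR R (p * p) =
    (R.map fun z => (aeval z p).re ^ 2 - (aeval z p).im ^ 2).sum := by
  rw [ellR_apply]
  congr 1
  refine Multiset.map_congr rfl fun z _ => ?_
  rw [map_mul, Complex.mul_re]
  ring

lemma conj_re (p : ℝ[X]) (z : ℂ) : (aeval ((starRingEnd ℂ) z) p).re = (aeval z p).re := by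
  rw [aeval_conj]; simp

lemma conj_im (p : ℝ[X]) (z : ℂ) : (aeval ((starRingEnd ℂ) z) p).im = - (aeval z p).im := by
  rw [aeval_conj]; simp

lemma real_im (p : ℝ[X]) (z : ℂ) (hz : z.im = 0) : (aeval z p).im = 0 := by
  have h := conj_im p z
  rw [Complex.conj_eq_iff_im.mpr hz] at h
  linarith

lemma inert_neg_le (f : ℝ[X]) (k a b : ℕ) (hI : Inert (ellR (cR f)) k a b) :
    b ≤ ((cR f).toFinset.filter fun z => 0 < z.im).card := by
  obtain ⟨P, N, h1, h2, h3, h4, h5, h6⟩ := hI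
  let φ : ℝ[X] →ₗ[ℝ] (((cR f).toFinset.filter fun z => 0 < z.im) → ℝ) :=
    LinearMap.pi fun z => Complex.imLm ∘ₗ (aeval (z : ℂ)).toLinearMap
  have hφ : ∀ p ∈ N, φ p = 0 → p = 0 := by
    intro p hp h0
    by_contra hne
    have hlt := h6 p hp hne
    have hge : 0 ≤ ellR (cR f) (p * p) := by
      rw [ell_sq]
      apply Multiset.sum_nonneg
      intro x hx
      obtain ⟨z, hz, rfl⟩ := Multiset.mem_map.mp hx
      have hz' := Multiset.mem_toFinset.mpr hz
      have hpos : ∀ w ∈ (cR f).toFinset, 0 < w.im → (aeval w p).im = 0 := fun w hw hw2 =>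
        congrFun h0 ⟨w, Finset.mem_filter.mpr ⟨hw, hw2⟩⟩
      have him : (aeval z p).im = 0 := by
        rcases lt_trichotomy z.im 0 with h | h | h
        · have := hpos _ (conj_mem f hz') (by simpa using h)
          rw [conj_im] at this
          linarith
        · exact real_im p z h
        · exact hpos z hz' h
      rw [him]
      nlinarith [sq_nonneg (aeval z p).re]
    linarith
  have hinj : Function.Injective (φ.domRestrict N) := by
    rw [← LinearMap.ker_eq_bot, LinearMap.ker_eq_bot']
    intro x hx
    exact Subtype.ext (hφ x x.2 hx)
  have := LinearMap.finrank_le_finrank_of_injective hinj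
  rw [h4] at this
  simpa using this

lemma inert_pos_le (f : ℝ[X]) (k a b : ℕ) (hI : Inert (ellR (cR f)) k a b) :
    a ≤ ((cR f).toFinset.filter fun z => 0 ≤ z.im).card := by
  obtain ⟨P, N, h1, h2, h3, h4, h5, h6⟩ := hI
  let φ : ℝ[X] →ₗ[ℝ] (((cR f).toFinset.filter fun z => 0 ≤ z.im) → ℝ) :=
    LinearMap.pi fun z => Complex.reLm ∘ₗ (aeval (z : ℂ)).toLinearMap
  have hφ : ∀ p ∈ P, φ p = 0 → p = 0 := by
    intro p hp h0
    by_contra hne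
    have hlt := h5 p hp hne
    have hge : 0 ≤ - ellR (cR f) (p * p) := by
      have hneg : - ellR (cR f) (p * p) =
          ((cR f).map fun z => (aeval z p).im ^ 2 - (aeval z p).re ^ 2).sum := by
        rw [ell_sq, ← Multiset.sum_map_neg]
        congr 1
        refine Multiset.map_congr rfl fun z _ => ?_
        ring
      rw [hneg]
      apply Multiset.sum_nonneg
      intro x hx
      obtain ⟨z, hz, rfl⟩ := Multiset.mem_map.mp hx
      have hz' := Multiset.mem_toFinset.mpr hz
      have hpos : ∀ w ∈ (cR f).toFinset, 0 ≤ w.im → (aeval w p).re = 0 := fun w hw hw2 =>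
        congrFun h0 ⟨w, Finset.mem_filter.mpr ⟨hw, hw2⟩⟩
      have him : (aeval z p).re = 0 := by
        rcases lt_or_ge z.im 0 with h | h
        · have := hpos _ (conj_mem f hz') (by simpa using h.le)
          rwa [conj_re] at this
        · exact hpos z hz' h
      rw [him]
      nlinarith [sq_nonneg (aeval z p).im]
    linarith
  have hinj : Function.Injective (φ.domRestrict P) := by
    rw [← LinearMap.ker_eq_bot, LinearMap.ker_eq_bot']
    intro x hx
    exact Subtype.ext (hφ x x.2 hx)
  have := LinearMap.finrank_le_finrank_of_injective hinj
  rw [h3] at this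
  simpa using this

lemma inert_top (f : ℝ[X]) (a b : ℕ) (hab : a + b = (cR f).toFinset.card)
    (hI : Inert (ellR (cR f)) (cR f).toFinset.card a b) :
    b = ((cR f).toFinset.filter fun z => 0 < z.im).card := by
  have h1 := inert_neg_le f _ a b hI
  have h2 := inert_pos_le f _ a b hI
  rw [card_nonneg] at h2
  have h3 := card_total f
  omega

/-! ### Combinatorics of the revised sign list -/

lemma find_last (P : ℕ → Bool) (q : ℕ) (hq : P q = true) (p : ℕ) (hp : q + 1 ≤ p)
    (h : ∀ j, q < j → j < p → P j = false) : (List.range p).reverse.find? P = some q := by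
  induction p, hp using Nat.le_induction with
  | base => simp [List.range_succ, hq]
  | succ m hm ih =>
    rw [List.range_succ, List.reverse_append]
    simp only [List.reverse_cons, List.reverse_nil, List.nil_append, List.cons_append]
    rw [List.find?_cons, h m (by omega) (by omega)]
    exact ih (fun j h1 h2 => h j h1 (by omega))

lemma reviseAt_ne (L : List ℤ) (p : ℕ) (h : L.getD p 0 ≠ 0) : reviseAt L p = L.getD p 0 := by
  unfold reviseAt
  rw [if_pos h]

lemma getD_ne_lt (L : List ℤ) (s : ℕ) (h : L.getD s 0 ≠ 0) : s < L.length := by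
  by_contra h2
  exact h (List.getD_eq_default _ _ (not_lt.mp h2))

lemma reviseAt_pat (L : List ℤ) (q p s : ℕ) (hqp : q ≤ p) (hps : p < s) (hq : L.getD q 0 ≠ 0)
    (hs : L.getD s 0 ≠ 0) (hz : ∀ j, q < j → j ≤ p → L.getD j 0 = 0) :
    reviseAt L p = zpattern (p - q) * L.getD q 0 := by
  rcases hqp.eq_or_lt with rfl | hlt
  · rw [reviseAt_ne L q hq]
    simp [zpattern]
  · unfold reviseAt
    rw [if_neg (by simpa using hz p hlt le_rfl)]
    rw [find_last (fun q => L.getD q 0 != 0) q (by simpa using hq) p hlt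
      (fun j h1 h2 => by simpa using hz j h1 h2.le)]
    simp only
    rw [if_pos]
    rw [List.any_eq_true]
    exact ⟨s, List.mem_range.mpr (getD_ne_lt L s hs), by simpa [hps] using hs⟩

lemma reviseAt_tail (L : List ℤ) (p : ℕ) (hz : ∀ j, p ≤ j → L.getD j 0 = 0) :
    reviseAt L p = 0 := by
  unfold reviseAt
  rw [if_neg (by simpa using hz p le_rfl)]
  cases hf : (List.range p).reverse.find? (fun q => L.getD q 0 != 0) with
  | none => rfl
  | some q =>
    simp only
    rw [if_neg]
    rw [List.any_eq_true]
    rintro ⟨s, _, h2⟩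
    simp only [Bool.and_eq_true, decide_eq_true_eq, bne_iff_ne] at h2
    exact h2.2 (hz s h2.1.le)

lemma revised_getD (L : List ℤ) (i : ℕ) (hi : i < L.length) :
    (revisedSignList L).getD i 0 = reviseAt L i := by
  unfold revisedSignList
  rw [List.getD_eq_getElem _ _ (by simpa using hi)]
  simp

lemma exists_prev (L : List ℤ) (h0 : L.getD 0 0 ≠ 0) (p : ℕ) (hp : 0 < p) :
    ∃ q, q < p ∧ L.getD q 0 ≠ 0 ∧ ∀ j, q < j → j < p → L.getD j 0 = 0 := by
  refine ⟨Nat.findGreatest (fun q => L.getD q 0 ≠ 0) (p - 1), ?_, ?_, ?_⟩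
  · have := Nat.findGreatest_le (P := fun q => L.getD q 0 ≠ 0) (p - 1)
    omega
  · exact Nat.findGreatest_spec (P := fun q => L.getD q 0 ≠ 0) (Nat.zero_le _) h0
  · intro j h1 h2
    have := Nat.findGreatest_is_greatest (P := fun q => L.getD q 0 ≠ 0) h1 (by omega)
    simpa using this

/-- Number of sign changes among the first `m + 1` entries of the revised list. -/
def chg (L : List ℤ) (m : ℕ) : ℕ :=
  (List.range m).countP fun i =>
    decide ((revisedSignList L).getD i 0 * (revisedSignList L).getD (i + 1) 0 < 0)

lemma chg_succ (L : List ℤ) (m : ℕ) : chg L (m + 1) = chg L m +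
    if (revisedSignList L).getD m 0 * (revisedSignList L).getD (m + 1) 0 < 0 then 1 else 0 := by
  unfold chg
  rw [List.range_succ, List.countP_append]
  simp [List.countP_cons]

lemma neg_one_pow_neg_iff (m : ℕ) : ((-1 : ℤ) ^ m < 0) ↔ m % 2 = 1 := by
  rcases Nat.even_or_odd m with h | h
  · rw [h.neg_one_pow]
    have := Nat.even_iff.mp h
    omega
  · rw [h.neg_one_pow]
    have := Nat.odd_iff.mp h
    omega

lemma comb_changes (L : List ℤ) (r : ℕ) (hr : 0 < r) (h0 : L.getD 0 0 ≠ 0)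
    (hr1 : L.getD (r - 1) 0 ≠ 0) (b : ℕ → ℕ) (hb0 : b 0 = 0)
    (hsgn : ∀ p, p < r → L.getD p 0 ≠ 0 → L.getD p 0 = (-1) ^ (b p))
    (hstep : ∀ p d, p + d + 1 < r → L.getD p 0 ≠ 0 → L.getD (p + d + 1) 0 ≠ 0 →
      (∀ j, p < j → j < p + d + 1 → L.getD j 0 = 0) →
      b p + (d + 1) / 2 ≤ b (p + d + 1) ∧ b (p + d + 1) + (d + 1) / 2 ≤ b p + d + 1) :
    ∀ p, p < r → L.getD p 0 ≠ 0 → chg L p = b p := by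
  intro p
  induction p using Nat.strong_induction_on with
  | _ p ih =>
    intro hpr hp0
    rcases Nat.eq_zero_or_pos p with rfl | hpos
    · simp [chg, hb0]
    obtain ⟨q, hqp, hq0, hqz⟩ := exists_prev L h0 p hpos
    obtain ⟨d, rfl⟩ : ∃ d, p = q + d + 1 := ⟨p - q - 1, by omega⟩
    have ihq := ih q hqp (by omega) hq0
    have hlen := getD_ne_lt L _ hp0
    have hst := hstep q d hpr hq0 hp0 hqz
    have hqs := hsgn q (by omega) hq0
    have hps := hsgn _ hpr hp0
    have hrev : ∀ j, j ≤ d → (revisedSignList L).getD (q + j) 0 =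
        (-1) ^ ((j + 1) / 2 + b q) := by
      intro j hj
      rw [revised_getD L _ (by omega), reviseAt_pat L q (q + j) (q + d + 1) (by omega) (by omega)
        hq0 hp0 (fun i h1 h2 => hqz i h1 (by omega)), hqs, pow_add]
      simp [zpattern]
    have hrevp : (revisedSignList L).getD (q + d + 1) 0 = (-1) ^ b (q + d + 1) := by
      rw [revised_getD L _ hlen, reviseAt_ne L _ hp0, hps]
    have hcount : ∀ j, j ≤ d → chg L (q + j) = b q + (j + 1) / 2 := by
      intro j
      induction j with
      | zero => intro _; simpa using ihq
      | succ j ihj =>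
        intro hj
        rw [← add_assoc, chg_succ, ihj (by omega), hrev j (by omega), add_assoc q j 1,
          hrev (j + 1) hj, ← pow_add]
        simp only [neg_one_pow_neg_iff]
        split_ifs with h <;> omega
    rw [chg_succ, hcount d le_rfl, hrev d le_rfl, hrevp, ← pow_add]
    simp only [neg_one_pow_neg_iff]
    split_ifs with h <;> omega

lemma comb_main (L : List ℤ) (r : ℕ) (hr : 0 < r) (h0 : L.getD 0 0 ≠ 0)
    (hr1 : L.getD (r - 1) 0 ≠ 0) (htail : ∀ j, r ≤ j → L.getD j 0 = 0) (b : ℕ → ℕ) (hb0 : b 0 = 0)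
    (hsgn : ∀ p, p < r → L.getD p 0 ≠ 0 → L.getD p 0 = (-1) ^ (b p))
    (hstep : ∀ p d, p + d + 1 < r → L.getD p 0 ≠ 0 → L.getD (p + d + 1) 0 ≠ 0 →
      (∀ j, p < j → j < p + d + 1 → L.getD j 0 = 0) →
      b p + (d + 1) / 2 ≤ b (p + d + 1) ∧ b (p + d + 1) + (d + 1) / 2 ≤ b p + d + 1) :
    signChanges (revisedSignList L) = b (r - 1) ∧ nonzeroCount (revisedSignList L) = r := by
  have hlen := getD_ne_lt L _ hr1
  have hlen' : (revisedSignList L).length = L.length := by simp [revisedSignList]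
  constructor
  · have h1 : signChanges (revisedSignList L) = chg L (L.length - 1) := by
      unfold signChanges chg
      rw [hlen']
    rw [h1, ← comb_changes L r hr h0 hr1 b hb0 hsgn hstep (r - 1) (by omega) hr1]
    have h2 : ∀ m, r - 1 + m ≤ L.length - 1 → chg L (r - 1 + m) = chg L (r - 1) := by
      intro m
      induction m with
      | zero => intro _; rfl
      | succ m ihm =>
        intro hm
        rw [← add_assoc, chg_succ, ihm (by omega), revised_getD L (r - 1 + m + 1) (by omega),
          reviseAt_tail L (r - 1 + m + 1) (fun j hj => htail j (by omega))]
        simp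
    have h3 := h2 (L.length - 1 - (r - 1)) (by omega)
    rw [← h3]
    congr 1
    omega
  · have hne : ∀ i, i < r → reviseAt L i ≠ 0 := by
      intro i hi
      by_cases hi0 : L.getD i 0 ≠ 0
      · rw [reviseAt_ne L i hi0]; exact hi0
      · rw [not_not] at hi0
        have hipos : 0 < i := by
          rcases Nat.eq_zero_or_pos i with rfl | h
          · exact absurd hi0 h0
          · exact h
        have hir : i ≠ r - 1 := by
          rintro rfl
          exact hr1 hi0
        obtain ⟨q, hq, hq0, hqz⟩ := exists_prev L h0 i hipos
        rw [reviseAt_pat L q i (r - 1) hq.le (by omega) hq0 hr1 (by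
          intro j h1 h2
          rcases h2.eq_or_lt with rfl | h3
          · exact hi0
          · exact hqz j h1 h3)]
        refine mul_ne_zero ?_ hq0
        simp [zpattern]
    have hcount : ∀ m, (List.range m).countP (fun i => reviseAt L i != 0) = min m r := by
      intro m
      induction m with
      | zero => simp
      | succ m ihm =>
        rw [List.range_succ, List.countP_append, ihm]
        by_cases hm : m < r
        · have := hne m hm
          simp only [List.countP_cons, List.countP_nil, bne_iff_ne, ne_eq, this, not_false_eq_true,
            if_true]
          omega
        · have := reviseAt_tail L m (fun j hj => htail j (by omega))
          simp [this]
          omega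
    unfold nonzeroCount revisedSignList
    rw [List.countP_map]
    have := hcount L.length
    rw [min_eq_right (by omega)] at this
    exact this

/-! ### Assembling the pieces -/

lemma rsign_mul_pos (c x : ℝ) (hc : 0 < c) : rsign (c * x) = rsign x := by
  unfold rsign
  have h1 : 0 < c * x ↔ 0 < x := mul_pos_iff_of_pos_left hc
  have h2 : c * x < 0 ↔ x < 0 := by
    constructor
    · intro h
      by_contra hx
      push Not at hx
      have := mul_nonneg hc.le hx
      linarith
    · intro h
      exact mul_neg_of_pos_of_neg hc h
  simp only [h1, h2]

lemma rsign_zero_iff (x : ℝ) : rsign x = 0 ↔ x = 0 := by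
  unfold rsign
  split_ifs with h1 h2
  · simp; exact h1.ne'
  · simp; exact h2.ne
  · simp; linarith

lemma rsign_eq_pow (x : ℝ) (b : ℕ) (h : 0 < (-1 : ℝ) ^ b * x) : rsign x = (-1) ^ b := by
  rcases Nat.even_or_odd b with hb | hb
  · rw [hb.neg_one_pow] at h ⊢
    have : 0 < x := by linarith
    simp [rsign, this]
  · rw [hb.neg_one_pow] at h ⊢
    have hx : x < 0 := by linarith
    simp [rsign, hx, not_lt.mpr hx.le]

lemma cR_card (f : ℝ[X]) : (cR f).card = f.natDegree := by
  unfold cR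
  rw [IsAlgClosed.card_roots_eq_natDegree, natDegree_map]

lemma hk_one (f : ℝ[X]) : (hkM (ellR (cR f)) 1).det = f.natDegree := by
  rw [Matrix.det_fin_one]
  have : hkM (ellR (cR f)) 1 0 0 = ellR (cR f) 1 := by
    simp [hkM]
  rw [this, ellR_apply, ← cR_card]
  simp

lemma signList_getD (n : ℕ) (f : ℝ[X]) (hdeg : f.natDegree = n) (hlead : f.coeff n ≠ 0) (p : ℕ)
    (hp : p < n) : (signList n (coeffSeq n f)).getD p 0 =
      rsign (hkM (ellR (cR f)) (p + 1)).det := by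
  have : (signList n (coeffSeq n f)).getD p 0 = rsign (discD n (coeffSeq n f) (p + 1)) := by
    unfold signList
    simp [List.getD, hp]
  rw [this, discD_hankel n f hdeg, rsign_mul_pos]
  rw [pow_mul]
  positivity

lemma main_count (n : ℕ) (hn : 0 < n) (f : ℝ[X]) (hdeg : f.natDegree = n)
    (hlead : f.coeff n ≠ 0) :
    signChanges (revisedSignList (signList n (coeffSeq n f))) =
      ((cR f).toFinset.filter fun z => 0 < z.im).card ∧
    nonzeroCount (revisedSignList (signList n (coeffSeq n f))) = (cR f).toFinset.card := by
  classical
  have hcard := cR_card f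
  rw [hdeg] at hcard
  set r := (cR f).toFinset.card with hrdef
  have hrn : r ≤ n := by
    rw [← hcard]
    exact Multiset.toFinset_card_le _
  have hr : 0 < r := by
    rw [hrdef, Finset.card_pos]
    obtain ⟨z, hz⟩ := Multiset.card_pos_iff_exists_mem.mp (by omega : 0 < (cR f).card)
    exact ⟨z, Multiset.mem_toFinset.mpr hz⟩
  have hget := signList_getD n f hdeg hlead
  have hnz : ∀ p, p < n → ((signList n (coeffSeq n f)).getD p 0 ≠ 0 ↔
      (hkM (ellR (cR f)) (p + 1)).det ≠ 0) := by
    intro p hp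
    rw [hget p hp, Ne, rsign_zero_iff]
  have hex : ∀ p, ∃ b : ℕ, (hkM (ellR (cR f)) (p + 1)).det ≠ 0 →
      ∃ a, a + b = p + 1 ∧ 0 < (-1 : ℝ) ^ b * (hkM (ellR (cR f)) (p + 1)).det ∧
        Inert (ellR (cR f)) (p + 1) a b := by
    intro p
    by_cases h : (hkM (ellR (cR f)) (p + 1)).det ≠ 0
    · obtain ⟨a, b, h1, h2, h3⟩ := exists_inert _ _ h
      exact ⟨b, fun _ => ⟨a, h1, h2, h3⟩⟩
    · exact ⟨0, fun h' => absurd h' h⟩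
  choose b hb using hex
  have hone : 0 < (hkM (ellR (cR f)) (0 + 1)).det := by
    have := hk_one f
    rw [zero_add, this, hdeg]
    exact_mod_cast hn
  have htop : (hkM (ellR (cR f)) (r - 1 + 1)).det ≠ 0 := by
    rw [Nat.sub_add_cancel hr]
    exact hankel_det_ne f
  have hb0 : b 0 = 0 := by
    obtain ⟨a, h1, h2, -⟩ := hb 0 hone.ne'
    by_contra hne
    have hb1 : b 0 = 1 := by omega
    rw [hb1] at h2
    linarith
  have hmain := comb_main (signList n (coeffSeq n f)) r hr ((hnz 0 hn).mpr hone.ne')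
    ((hnz (r - 1) (by omega)).mpr htop) ?_ b hb0 ?_ ?_
  · refine ⟨?_, hmain.2⟩
    rw [hmain.1]
    obtain ⟨a, h1, -, h3⟩ := hb (r - 1) htop
    rw [Nat.sub_add_cancel hr] at h1 h3
    exact inert_top f a _ h1 h3
  · intro j hj
    by_cases hjn : j < n
    · rw [hget j hjn, rsign_zero_iff]
      exact hankel_det_zero f (j + 1) (by omega)
    · rw [List.getD_eq_default]
      simpa [signList] using hjn
  · intro p hp hne
    have hd := (hnz p (by omega)).mp hne
    obtain ⟨a, -, h2, -⟩ := hb p hd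
    rw [hget p (by omega)]
    exact rsign_eq_pow _ _ h2
  · intro p d hpd hne hne' hz
    have hd := (hnz p (by omega)).mp hne
    have hd' := (hnz (p + d + 1) (by omega)).mp hne'
    obtain ⟨a, h1, -, h3⟩ := hb p hd
    obtain ⟨a', h1', -, h3'⟩ := hb (p + d + 1) hd'
    have he : p + d + 1 + 1 = p + 1 + d + 1 := by omega
    rw [he] at h1' h3'
    refine frob_step (ellR (cR f)) (p + 1) d a (b p) a' (b (p + d + 1)) hd ?_ h1 h3 h3' h1'
    intro j hj1 hj2
    have := hz (p + j) (by omega) (by omega)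
    rw [hget (p + j) (by omega), rsign_zero_iff] at this
    rw [show p + 1 + j = p + j + 1 by omega]
    exact this

/-- **Root counting via the revised sign list.**
Let `f` be a real polynomial of degree `n` with nonzero leading coefficient, let `K` be the
number of sign changes and `L` the number of nonzero members of the revised sign list of the
discriminant sequence `{ⁿD₁, …, ⁿDₙ}` of `f`.  Then `f` has exactly `K` distinct pairs of
complex-conjugate non-real roots (i.e. exactly `2K` distinct non-real complex roots) and
exactly `L − 2K` distinct real roots. -/
theorem stmt2 (n : ℕ) (hn : 0 < n) (f : Polynomial ℝ) (hdeg : f.natDegree = n)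
    (hlead : f.coeff n ≠ 0) (K L : ℕ)
    (hK : K = signChanges (revisedSignList (signList n (coeffSeq n f))))
    (hL : L = nonzeroCount (revisedSignList (signList n (coeffSeq n f)))) :
    ((f.map (algebraMap ℝ ℂ)).roots.toFinset.filter fun z => z.im ≠ 0).card = 2 * K ∧
    f.roots.toFinset.card = L - 2 * K := by
  have hf : f ≠ 0 := by
    rintro rfl
    simp at hlead
  obtain ⟨h1, h2⟩ := main_count n hn f hdeg hlead
  rw [← hK] at h1
  rw [← hL] at h2
  have h3 := card_nonreal f
  have h4 := card_real f hf
  have h5 := card_total f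
  unfold cR at h1 h2 h3 h4 h5
  refine ⟨by omega, by omega⟩
end

section
/- Let f = x⁴ + a₂x² + a₃x + a₄ be a monic real quartic with zero cubic coefficient, let {⁴D₁, ⁴D₂, ⁴D₃, ⁴D₄} be its discriminant sequence, let S_k denote the sum of the k-th powers of its roots, and set ⁴E₂ = S₃² + 2S₂³ − 4S₂S₄. Then: (i) if ⁴D₄ = 0, ⁴D₃ > 0 and ⁴D₂ > 0, then f has exactly three distinct roots, all real (one double root and two simple roots, type {(11)11}); (ii) if ⁴D₄ = 0, ⁴D₃ = 0 and ⁴D₂ > 0, then f has two distinct real double roots (type {(11)(11)}) if and only if ⁴E₂ > 0, and f has a real triple root together with a distinct real simple root (type {(111)1}) if and only if ⁴E₂ = 0. -/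
open Polynomial Matrix

lemma aux_sub (a2 a3 a4 : ℝ) (i : ℕ) : coeffSeq 4 (X ^ 4 + C a2 * X ^ 2 + C a3 * X + C a4) i =
   (if i = 0 then 1 else if i = 2 then a2 else if i = 3 then a3 else if 4 ≤ i then a4 else 0) := by
  unfold coeffSeq
  rcases i with _ | _ | _ | _ | i <;> simp [coeff_X, coeff_C, coeff_X_pow]

lemma D2_eq (a2 a3 a4 : ℝ) : polyDiscD 4 (X ^ 4 + C a2 * X ^ 2 + C a3 * X + C a4) 2 = -8 * a2 := by
  unfold polyDiscD discD discMinor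
  simp [Matrix.det_succ_column_zero, Fin.sum_univ_succ, discEntry, aux_sub, Fin.succAbove]
  ring

lemma det_step {n : ℕ} (A : Matrix (Fin (n + 1)) (Fin (n + 1)) ℝ) (i : Fin (n + 1))
    (h : ∀ j, j ≠ i → A j 0 = 0) :
    A.det = (-1) ^ (i : ℕ) * A i 0 * (A.submatrix i.succAbove Fin.succ).det := by
  rw [Matrix.det_succ_column_zero]
  refine Finset.sum_eq_single i ?_ (by simp)
  intro j _ hj
  simp [h j hj]

lemma det_five (a2 a3 a4 : ℝ) :
    (!![a2 / 2, 3 / 4 * a3, a4, 0, 0;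
        0, a2 / 2, 3 / 4 * a3, a4, 0;
        4, 0, 2 * a2, a3, 0;
        0, 0, a2 / 2, 3 / 4 * a3, a4;
        0, 4, 0, 2 * a2, a3] : Matrix (Fin 5) (Fin 5) ℝ).det =
    - (256 * a4 ^ 3 - 128 * a2 ^ 2 * a4 ^ 2 + 144 * a2 * a3 ^ 2 * a4 - 27 * a3 ^ 4
     + 16 * a2 ^ 4 * a4 - 4 * a2 ^ 3 * a3 ^ 2) / 16 := by
  simp [Matrix.det_succ_column_zero, Fin.sum_univ_succ, Fin.succAbove]
  ring

/-- The elimination matrix: subtract a quarter of each derivative row from the next row. -/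
noncomputable def elimL : Matrix (Fin 8) (Fin 8) ℝ :=
  !![1, 0, 0, 0, 0, 0, 0, 0;
     0, 1, 0, 0, 0, 0, 0, 0;
     0, -1/4, 1, 0, 0, 0, 0, 0;
     0, 0, 0, 1, 0, 0, 0, 0;
     0, 0, 0, -1/4, 1, 0, 0, 0;
     0, 0, 0, 0, 0, 1, 0, 0;
     0, 0, 0, 0, 0, -1/4, 1, 0;
     0, 0, 0, 0, 0, 0, 0, 1]

lemma det_elimL : elimL.det = 1 := by
  have h : elimL.IsLowerTriangular := by
    intro i j hij
    fin_cases i <;> fin_cases j <;> first | rfl | (exfalso; revert hij; decide)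
  rw [Matrix.det_of_isLowerTriangular _ h]
  simp [Fin.prod_univ_succ, elimL]

set_option maxHeartbeats 1000000 in
lemma elim_mul (a2 a3 a4 : ℝ) : elimL *
    !![1, 0, a2, a3, a4, 0, 0, 0;
       0, 4, 0, 2 * a2, a3, 0, 0, 0;
       0, 1, 0, a2, a3, a4, 0, 0;
       0, 0, 4, 0, 2 * a2, a3, 0, 0;
       0, 0, 1, 0, a2, a3, a4, 0;
       0, 0, 0, 4, 0, 2 * a2, a3, 0;
       0, 0, 0, 1, 0, a2, a3, a4;
       0, 0, 0, 0, 4, 0, 2 * a2, a3] =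
    !![1, 0, a2, a3, a4, 0, 0, 0;
       0, 4, 0, 2 * a2, a3, 0, 0, 0;
       0, 0, 0, a2 / 2, 3 / 4 * a3, a4, 0, 0;
       0, 0, 4, 0, 2 * a2, a3, 0, 0;
       0, 0, 0, 0, a2 / 2, 3 / 4 * a3, a4, 0;
       0, 0, 0, 4, 0, 2 * a2, a3, 0;
       0, 0, 0, 0, 0, a2 / 2, 3 / 4 * a3, a4;
       0, 0, 0, 0, 4, 0, 2 * a2, a3] := by
  ext i j
  fin_cases i <;> fin_cases j <;>
    simp [elimL, Matrix.mul_apply, Fin.sum_univ_succ] <;> ring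

set_option maxHeartbeats 2000000 in
lemma D4_eq (a2 a3 a4 : ℝ) : polyDiscD 4 (X ^ 4 + C a2 * X ^ 2 + C a3 * X + C a4) 4 = 
   256 * a4 ^ 3 - 128 * a2 ^ 2 * a4 ^ 2 + 144 * a2 * a3 ^ 2 * a4 - 27 * a3 ^ 4
     + 16 * a2 ^ 4 * a4 - 4 * a2 ^ 3 * a3 ^ 2 := by
  unfold polyDiscD discD discMinor
  have hA : (Matrix.of fun r c : Fin 8 => discEntry 4
      (coeffSeq 4 (X ^ 4 + C a2 * X ^ 2 + C a3 * X + C a4)) r.val c.val) =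
    !![1, 0, a2, a3, a4, 0, 0, 0;
       0, 4, 0, 2 * a2, a3, 0, 0, 0;
       0, 1, 0, a2, a3, a4, 0, 0;
       0, 0, 4, 0, 2 * a2, a3, 0, 0;
       0, 0, 1, 0, a2, a3, a4, 0;
       0, 0, 0, 4, 0, 2 * a2, a3, 0;
       0, 0, 0, 1, 0, a2, a3, a4;
       0, 0, 0, 0, 4, 0, 2 * a2, a3] := by
    ext i j
    fin_cases i <;> fin_cases j <;> simp [discEntry, aux_sub]
  change (Matrix.of fun r c : Fin 8 => discEntry 4
      (coeffSeq 4 (X ^ 4 + C a2 * X ^ 2 + C a3 * X + C a4)) r.val c.val).det = _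
  have hL := congrArg Matrix.det (elim_mul a2 a3 a4)
  rw [Matrix.det_mul, det_elimL, one_mul] at hL
  rw [hA, hL]
  rw [det_step _ 0 (by intro j hj; fin_cases j <;> first | rfl | exact absurd rfl hj)]
  rw [det_step _ 0 (by intro j hj; fin_cases j <;> first | rfl | exact absurd rfl hj)]
  rw [det_step _ 1 (by intro j hj; fin_cases j <;> first | rfl | exact absurd rfl hj)]
  have h5 := det_five a2 a3 a4
  generalize hM : (!![a2 / 2, 3 / 4 * a3, a4, 0, 0;
        0, a2 / 2, 3 / 4 * a3, a4, 0;
        4, 0, 2 * a2, a3, 0;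
        0, 0, a2 / 2, 3 / 4 * a3, a4;
        0, 4, 0, 2 * a2, a3] : Matrix (Fin 5) (Fin 5) ℝ) = M at h5
  rw [show Matrix.submatrix _ _ _ = M from ?_, h5]
  · simp
    ring
  · rw [← hM]
    ext i j
    fin_cases i <;> fin_cases j <;> rfl

lemma det_five' (a2 a3 a4 : ℝ) :
    (!![4, 0, 2 * a2, a3, 0;
       1, 0, a2, a3, a4;
       0, 4, 0, 2 * a2, a3;
       0, 1, 0, a2, a3;
       0, 0, 4, 0, 2 * a2] : Matrix (Fin 5) (Fin 5) ℝ).det =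
    4 * (8 * a2 * a4 - 2 * a2 ^ 3 - 9 * a3 ^ 2) := by
  simp [Matrix.det_succ_column_zero, Fin.sum_univ_succ, Fin.succAbove]
  ring

set_option maxHeartbeats 2000000 in
lemma D3_eq (a2 a3 a4 : ℝ) : polyDiscD 4 (X ^ 4 + C a2 * X ^ 2 + C a3 * X + C a4) 3 =
   4 * (8 * a2 * a4 - 2 * a2 ^ 3 - 9 * a3 ^ 2) := by
  unfold polyDiscD discD discMinor
  have hA : (Matrix.of fun r c : Fin 6 => discEntry 4
      (coeffSeq 4 (X ^ 4 + C a2 * X ^ 2 + C a3 * X + C a4)) r.val c.val) =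
    !![1, 0, a2, a3, a4, 0;
       0, 4, 0, 2 * a2, a3, 0;
       0, 1, 0, a2, a3, a4;
       0, 0, 4, 0, 2 * a2, a3;
       0, 0, 1, 0, a2, a3;
       0, 0, 0, 4, 0, 2 * a2] := by
    ext i j
    fin_cases i <;> fin_cases j <;> simp [discEntry, aux_sub]
  change (Matrix.of fun r c : Fin 6 => discEntry 4
      (coeffSeq 4 (X ^ 4 + C a2 * X ^ 2 + C a3 * X + C a4)) r.val c.val).det = _
  rw [hA, det_step _ 0 (by intro j hj; fin_cases j <;> first | rfl | exact absurd rfl hj),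
    ← det_five']
  generalize hM : (!![4, 0, 2 * a2, a3, 0;
       1, 0, a2, a3, a4;
       0, 4, 0, 2 * a2, a3;
       0, 1, 0, a2, a3;
       0, 0, 4, 0, 2 * a2] : Matrix (Fin 5) (Fin 5) ℝ) = M
  rw [show Matrix.submatrix _ _ _ = M from ?_]
  · simp
  · rw [← hM]
    ext i j
    fin_cases i <;> fin_cases j <;> rfl

lemma power_sums (a2 a3 a4 : ℝ) (f : Polynomial ℝ)
    (hf : f = X ^ 4 + C a2 * X ^ 2 + C a3 * X + C a4)
    (Sp : ℕ → ℝ)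
    (hSp : ∀ k, (Sp k : ℂ) = ((f.map (algebraMap ℝ ℂ)).roots.map fun z => z ^ k).sum) :
    Sp 2 = -2 * a2 ∧ Sp 3 = -3 * a3 ∧ Sp 4 = 2 * a2 ^ 2 - 4 * a4 := by
  set g := f.map (algebraMap ℝ ℂ) with hg
  have hg' : g = X ^ 4 + C (a2 : ℂ) * X ^ 2 + C (a3 : ℂ) * X + C (a4 : ℂ) := by
    rw [hg, hf]; simp
  have hdeg : g.natDegree = 4 := by rw [hg']; compute_degree!
  have hmon : g.Monic := by rw [hg']; monicity!
  have hs : g.Splits := IsAlgClosed.splits g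
  have hcard : g.roots.card = 4 := by rw [← hdeg]; exact hs.natDegree_eq_card_roots.symm
  have hprod : g = (g.roots.map (X - C ·)).prod := hs.eq_prod_roots_of_monic hmon
  generalize g.roots = m at hcard hprod hSp
  induction m using Quotient.inductionOn with
  | h l =>
  match l, hcard with
  | [p, q, r, s], _ =>
  have h2 := hSp 2
  have h3 := hSp 3
  have h4 := hSp 4
  simp at h2 h3 h4 hprod
  rw [hg'] at hprod
  have hE : X ^ 4 + C (a2 : ℂ) * X ^ 2 + C (a3 : ℂ) * X + C (a4 : ℂ) =
      X ^ 4 + C (-(p + q + r + s)) * X ^ 3 + C (p*q+p*r+p*s+q*r+q*s+r*s) * X ^ 2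
       + C (-(p*q*r+p*q*s+p*r*s+q*r*s)) * X + C (p*q*r*s) := by
    rw [hprod]; simp only [map_add, map_mul, map_neg]; ring
  have c0 := congrArg (fun t => coeff t 0) hE
  have c1 := congrArg (fun t => coeff t 1) hE
  have c2 := congrArg (fun t => coeff t 2) hE
  have c3 := congrArg (fun t => coeff t 3) hE
  simp [coeff_X, coeff_C, coeff_X_pow, -map_add, -map_mul, -map_neg] at c0 c1 c2 c3
  have hp : p = -(q + r + s) := by linear_combination c3
  refine ⟨?_, ?_, ?_⟩
  · have : (Sp 2 : ℂ) = ((-2 * a2 : ℝ) : ℂ) := by push_cast; rw [h2, c2, hp]; ring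
    exact_mod_cast this
  · have : (Sp 3 : ℂ) = ((-3 * a3 : ℝ) : ℂ) := by push_cast; rw [h3, c1, hp]; ring
    exact_mod_cast this
  · have : (Sp 4 : ℂ) = ((2 * a2 ^ 2 - 4 * a4 : ℝ) : ℂ) := by push_cast; rw [h4, c2, c0, hp]; ring
    exact_mod_cast this

lemma part_one (a2 a3 a4 : ℝ)
    (h4 : 256 * a4 ^ 3 - 128 * a2 ^ 2 * a4 ^ 2 + 144 * a2 * a3 ^ 2 * a4 - 27 * a3 ^ 4
     + 16 * a2 ^ 4 * a4 - 4 * a2 ^ 3 * a3 ^ 2 = 0)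
    (h3 : 0 < 8 * a2 * a4 - 2 * a2 ^ 3 - 9 * a3 ^ 2) (h2 : a2 < 0) :
    ∃ x y z : ℝ, x ≠ y ∧ x ≠ z ∧ y ≠ z ∧
      (X ^ 4 + C a2 * X ^ 2 + C a3 * X + C a4 : Polynomial ℝ)
        = (X - C x) ^ 2 * (X - C y) * (X - C z) := by
  obtain ⟨x, hx⟩ : ∃ x, x * (8 * a2 * a4 - 2 * a2 ^ 3 - 9 * a3 ^ 2) = a3 * (a2 ^ 2 + 12 * a4) :=
    ⟨a3 * (a2 ^ 2 + 12 * a4) / (8 * a2 * a4 - 2 * a2 ^ 3 - 9 * a3 ^ 2), div_mul_cancel₀ _ h3.ne'⟩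
  set d := 8 * a2 * a4 - 2 * a2 ^ 3 - 9 * a3 ^ 2 with hd
  have hq0 : 2 * a2 * x ^ 2 + 3 * a3 * x + 4 * a4 = 0 := by
    have : d ^ 2 * (2 * a2 * x ^ 2 + 3 * a3 * x + 4 * a4) = d ^ 2 * 0 := by
      have e : d ^ 2 * (2 * a2 * x ^ 2 + 3 * a3 * x + 4 * a4) =
        2 * a2 * (x * d) ^ 2 + 3 * a3 * (x * d) * d + 4 * a4 * d ^ 2 := by ring
      rw [e, hx, hd]
      linear_combination a2 ^ 2 * h4
    exact mul_left_cancel₀ (by positivity) this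
  have e3 : a3 = -4 * x ^ 3 - 2 * a2 * x := by
    have : a2 ^ 2 * a3 = a2 ^ 2 * (-4 * x ^ 3 - 2 * a2 * x) := by
      rw [hd] at hx
      linear_combination (2 * a2 * x - 3 * a3) * hq0 - hx
    exact mul_left_cancel₀ (pow_ne_zero 2 h2.ne) this
  have e4 : a4 = 3 * x ^ 4 + a2 * x ^ 2 := by
    linear_combination hq0 / 4 - 3 / 4 * x * e3
  have hd' : d = -2 * (6 * x ^ 2 + a2) ^ 2 * (a2 + 2 * x ^ 2) := by
    rw [hd, e4, e3]; ring
  have hq : 6 * x ^ 2 + a2 ≠ 0 := by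
    intro h; rw [h] at hd'; simp at hd'; linarith
  have hr : 0 < -(a2 + 2 * x ^ 2) := by
    by_contra h
    have : 0 ≤ (6 * x ^ 2 + a2) ^ 2 * (a2 + 2 * x ^ 2) := mul_nonneg (sq_nonneg _) (by linarith)
    linarith
  obtain ⟨s, hs0, hs⟩ : ∃ s : ℝ, 0 < s ∧ s ^ 2 = -(a2 + 2 * x ^ 2) :=
    ⟨_, Real.sqrt_pos.2 hr, Real.sq_sqrt hr.le⟩
  have ha2 : a2 = - s ^ 2 - 2 * x ^ 2 := by linarith
  refine ⟨x, -x + s, -x - s, ?_, ?_, ?_, ?_⟩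
  · intro h; apply hq; rw [ha2]; have : s = 2 * x := by linarith
    rw [this]; ring
  · intro h; apply hq; rw [ha2]; have : s = -2 * x := by linarith
    rw [this]; ring
  · intro h; linarith
  · rw [e4, e3, ha2]; simp only [map_add, map_mul, map_neg, map_sub, map_pow, map_ofNat]; ring

lemma part_two (a2 a3 a4 : ℝ)
    (h4 : 256 * a4 ^ 3 - 128 * a2 ^ 2 * a4 ^ 2 + 144 * a2 * a3 ^ 2 * a4 - 27 * a3 ^ 4
     + 16 * a2 ^ 4 * a4 - 4 * a2 ^ 3 * a3 ^ 2 = 0)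
    (h3 : 8 * a2 * a4 - 2 * a2 ^ 3 - 9 * a3 ^ 2 = 0) (h2 : a2 < 0) :
    (a3 = 0 ∧ 4 * a4 = a2 ^ 2) ∨ (a2 ^ 2 = -12 * a4 ∧ 9 * a3 ^ 2 = 32 * a2 * a4) := by
  have key : (a3 * (a2 ^ 2 + 12 * a4)) ^ 2 = 0 := by
    have : a2 * (a3 * (a2 ^ 2 + 12 * a4)) ^ 2 = a2 * 0 := by
      linear_combination a2 ^ 2 / 2 * h4 - (3 * a3 * (a3 * (a2 ^ 2 + 12 * a4)) + 4 * a4 * (8 * a2 * a4 - 2 * a2 ^ 3 - 9 * a3 ^ 2)) / 2 * h3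
    exact mul_left_cancel₀ h2.ne this
  rcases mul_eq_zero.1 (pow_eq_zero_iff (two_ne_zero) |>.1 key) with h | h
  · left
    refine ⟨h, ?_⟩
    rw [h] at h3
    have : a2 * (4 * a4) = a2 * a2 ^ 2 := by linarith
    exact mul_left_cancel₀ h2.ne this
  · right
    refine ⟨by linarith, ?_⟩
    linear_combination -h3 - 2 * a2 * h

lemma coeffs_of_eq (a2 a3 a4 b1 b2 b3 b4 : ℝ)
    (h : (X ^ 4 + C a2 * X ^ 2 + C a3 * X + C a4 : Polynomial ℝ) =
      X ^ 4 + C b1 * X ^ 3 + C b2 * X ^ 2 + C b3 * X + C b4) :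
    0 = b1 ∧ a2 = b2 ∧ a3 = b3 ∧ a4 = b4 := by
  have c0 := congrArg (fun t => coeff t 0) h
  have c1 := congrArg (fun t => coeff t 1) h
  have c2 := congrArg (fun t => coeff t 2) h
  have c3 := congrArg (fun t => coeff t 3) h
  simp [coeff_X, coeff_C, coeff_X_pow] at c0 c1 c2 c3
  exact ⟨c3, c2, c1, c0⟩

/-- **Degenerate-root classification of a trace-free real quartic.**
Let `f = x⁴ + a₂x² + a₃x + a₄` with discriminant sequence `{⁴D₁, …, ⁴D₄}`, let `S_k` be the
`k`-th power sum of its (complex) roots, and `⁴E₂ = S₃² + 2S₂³ − 4S₂S₄`.  Then: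
(i) if `⁴D₄ = 0`, `⁴D₃ > 0`, `⁴D₂ > 0`, then `f` has exactly three distinct roots, all real
(one double, two simple — type `{(11)11}`);
(ii) if `⁴D₄ = 0`, `⁴D₃ = 0`, `⁴D₂ > 0`, then `f` has two distinct real double roots
(type `{(11)(11)}`) iff `⁴E₂ > 0`, and `f` has a real triple root and a distinct real simple
root (type `{(111)1}`) iff `⁴E₂ = 0`. -/
theorem stmt17 (a2 a3 a4 : ℝ) (f : Polynomial ℝ)
    (hf : f = X ^ 4 + C a2 * X ^ 2 + C a3 * X + C a4)
    (Sp : ℕ → ℝ)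
    (hSp : ∀ k, (Sp k : ℂ) = ((f.map (algebraMap ℝ ℂ)).roots.map fun z => z ^ k).sum)
    (E2 : ℝ) (hE2 : E2 = Sp 3 ^ 2 + 2 * Sp 2 ^ 3 - 4 * Sp 2 * Sp 4) :
    ((polyDiscD 4 f 4 = 0 ∧ 0 < polyDiscD 4 f 3 ∧ 0 < polyDiscD 4 f 2) →
      ∃ x y z : ℝ, x ≠ y ∧ x ≠ z ∧ y ≠ z ∧
        f = (X - C x) ^ 2 * (X - C y) * (X - C z)) ∧
    ((polyDiscD 4 f 4 = 0 ∧ polyDiscD 4 f 3 = 0 ∧ 0 < polyDiscD 4 f 2) →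
      ((0 < E2 ↔ ∃ x y : ℝ, x ≠ y ∧ f = (X - C x) ^ 2 * (X - C y) ^ 2) ∧
       (E2 = 0 ↔ ∃ x y : ℝ, x ≠ y ∧ f = (X - C x) ^ 3 * (X - C y)))) := by
  obtain ⟨s2, s3, s4⟩ := power_sums a2 a3 a4 f hf Sp hSp
  have hE : E2 = 9 * a3 ^ 2 - 32 * a2 * a4 := by
    rw [hE2, s2, s3, s4]; ring
  clear hSp hE2
  rw [hf, D2_eq, D3_eq, D4_eq]
  constructor
  · rintro ⟨h4, h3, h2⟩
    exact part_one a2 a3 a4 h4 (by linarith) (by linarith)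
  · rintro ⟨h4, h3, h2⟩
    have h2' : a2 < 0 := by linarith
    have back1 : (∃ x y : ℝ, x ≠ y ∧ (X ^ 4 + C a2 * X ^ 2 + C a3 * X + C a4 : Polynomial ℝ)
        = (X - C x) ^ 2 * (X - C y) ^ 2) → 0 < E2 := by
      rintro ⟨x, y, hxy, h⟩
      obtain ⟨c1, c2, c3, c4⟩ := coeffs_of_eq a2 a3 a4 (-2 * (x + y)) (x ^ 2 + 4 * x * y + y ^ 2)
        (-2 * x * y * (x + y)) (x ^ 2 * y ^ 2) (by
          rw [h]; simp only [map_add, map_mul, map_neg, map_pow, map_ofNat]; ring)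
      have hy : y = -x := by linarith
      subst hy
      have hx : x ≠ 0 := by rintro rfl; simp at hxy
      have : E2 = 64 * x ^ 6 := by rw [hE, c2, c3, c4]; ring
      rw [this]; positivity
    have back2 : (∃ x y : ℝ, x ≠ y ∧ (X ^ 4 + C a2 * X ^ 2 + C a3 * X + C a4 : Polynomial ℝ)
        = (X - C x) ^ 3 * (X - C y)) → E2 = 0 := by
      rintro ⟨x, y, hxy, h⟩
      obtain ⟨c1, c2, c3, c4⟩ := coeffs_of_eq a2 a3 a4 (-(3 * x + y)) (3 * x ^ 2 + 3 * x * y)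
        (-(x ^ 3 + 3 * x ^ 2 * y)) (x ^ 3 * y) (by
          rw [h]; simp only [map_add, map_mul, map_neg, map_pow, map_ofNat]; ring)
      have hy : y = -(3 * x) := by linarith
      subst hy
      rw [hE, c2, c3, c4]; ring
    rcases part_two a2 a3 a4 h4 (by linarith) h2' with ⟨h30, h44⟩ | ⟨h44, h33⟩
    · obtain ⟨s, hs0, hs⟩ : ∃ s : ℝ, 0 < s ∧ s ^ 2 = -a2 / 2 :=
        ⟨_, Real.sqrt_pos.2 (by linarith), Real.sq_sqrt (by linarith)⟩
      have ha2 : a2 = -2 * s ^ 2 := by linarith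
      have ha4 : a4 = s ^ 4 := by rw [ha2] at h44; linarith
      have fac : ∃ x y : ℝ, x ≠ y ∧ (X ^ 4 + C a2 * X ^ 2 + C a3 * X + C a4 : Polynomial ℝ)
        = (X - C x) ^ 2 * (X - C y) ^ 2 := by
        refine ⟨s, -s, by linarith [hs0] |> fun h : -s < s => h.ne', ?_⟩
        rw [ha4, ha2, h30]
        simp only [map_mul, map_neg, map_pow, map_ofNat, map_zero]; ring
      have hpos := back1 fac
      exact ⟨⟨fun _ => fac, back1⟩, ⟨fun h => absurd h hpos.ne', back2⟩⟩
    · have hz : E2 = 0 := by rw [hE]; linarith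
      have ha4 : a4 = -a2 ^ 2 / 12 := by linarith
      obtain ⟨t, ht⟩ : ∃ t, 4 * a2 * t = -3 * a3 := ⟨-3 * a3 / (4 * a2),
        mul_div_cancel₀ _ (mul_ne_zero four_ne_zero h2'.ne)⟩
      have ht2 : a2 = -6 * t ^ 2 := by
        have : a2 ^ 2 * a2 = a2 ^ 2 * (-6 * t ^ 2) := by
          rw [ha4] at h33
          have h16 : (4 * a2 * t) ^ 2 = (-3 * a3) ^ 2 := by rw [ht]
          linear_combination (3/8) * h33 + (3/8) * h16
        exact mul_left_cancel₀ (pow_ne_zero 2 h2'.ne) this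
      have ht0 : t ≠ 0 := by rintro rfl; simp at ht2; linarith
      have ha3 : a3 = 8 * t ^ 3 := by rw [ht2] at ht; linarith
      have ha4' : a4 = -3 * t ^ 4 := by rw [ha4, ht2]; ring
      have fac : ∃ x y : ℝ, x ≠ y ∧ (X ^ 4 + C a2 * X ^ 2 + C a3 * X + C a4 : Polynomial ℝ)
        = (X - C x) ^ 3 * (X - C y) := by
        refine ⟨t, -3 * t, fun h => ht0 (by linarith), ?_⟩
        rw [ha4', ha3, ht2]
        simp only [map_mul, map_neg, map_pow, map_ofNat]; ring
      exact ⟨⟨fun h => absurd hz h.ne', back1⟩, ⟨fun _ => fac, back2⟩⟩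
end

section
/- Let f = x⁴ + a₂x² + a₃x + a₄ be a monic real quartic with zero cubic coefficient and discriminant sequence {⁴D₁, ⁴D₂, ⁴D₃, ⁴D₄}. Then: (i) f has four distinct real roots if and only if ⁴D₄ > 0, ⁴D₃ > 0 and ⁴D₂ > 0; (ii) f has two distinct pairs of complex-conjugate non-real roots (and no real roots) if and only if ⁴D₄ > 0 and it is not the case that both ⁴D₃ > 0 and ⁴D₂ > 0; (iii) f has exactly one pair of complex-conjugate non-real roots together with two distinct real roots if and only if ⁴D₄ < 0. -/
open Polynomial Matrix

theorem quartic_d2 (a2 a3 : ℝ) (a : ℕ → ℝ) (h0 : a 0 = 1) (h1 : a 1 = 0) (h2 : a 2 = a2)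
    (h3 : a 3 = a3) : discD 4 a 2 = -8 * a2 := by
  have : (Matrix.of fun r c : Fin 4 => discEntry 4 a r.val c.val)
      = !![1,0,a2,a3; 0,4,0,2*a2; 0,1,0,a2; 0,0,4,0] := by
    ext i j
    fin_cases i <;> fin_cases j <;> simp [discEntry, h0,h1,h2,h3]
  unfold discD discMinor
  refine (congrArg Matrix.det this).trans ?_
  simp [Matrix.det_succ_column_zero, Fin.sum_univ_succ, Fin.succAbove]
  ring

set_option maxHeartbeats 4000000 in
theorem quartic_d3 (a2 a3 a4 : ℝ) (a : ℕ → ℝ) (h0 : a 0 = 1) (h1 : a 1 = 0) (h2 : a 2 = a2)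
    (h3 : a 3 = a3) (h4 : a 4 = a4) :
    discD 4 a 3 = 4 * (-2*a2^3+8*a2*a4-9*a3^2) := by
  have : (Matrix.of fun r c : Fin 6 => discEntry 4 a r.val c.val)
      = !![1,0,a2,a3,a4,0; 0,4,0,2*a2,a3,0; 0,1,0,a2,a3,a4; 0,0,4,0,2*a2,a3;
           0,0,1,0,a2,a3; 0,0,0,4,0,2*a2] := by
    ext i j
    fin_cases i <;> fin_cases j <;> simp [discEntry, h0,h1,h2,h3,h4]
  unfold discD discMinor
  refine (congrArg Matrix.det this).trans ?_
  simp [Matrix.det_succ_column_zero, Fin.sum_univ_succ, Fin.succAbove]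
  ring

set_option maxHeartbeats 4000000 in
theorem quartic_d4 (a2 a3 a4 : ℝ) (a : ℕ → ℝ) (h0 : a 0 = 1) (h1 : a 1 = 0) (h2 : a 2 = a2)
    (h3 : a 3 = a3) (h4 : a 4 = a4) :
    discD 4 a 4 = 16*a2^4*a4 - 4*a2^3*a3^2 - 128*a2^2*a4^2 + 144*a2*a3^2*a4 - 27*a3^4
      + 256*a4^3 := by
  have : (Matrix.of fun r c : Fin 8 => discEntry 4 a r.val c.val)
      = !![1,0,a2,a3,a4,0,0,0; 0,4,0,2*a2,a3,0,0,0; 0,1,0,a2,a3,a4,0,0; 0,0,4,0,2*a2,a3,0,0;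
           0,0,1,0,a2,a3,a4,0; 0,0,0,4,0,2*a2,a3,0; 0,0,0,1,0,a2,a3,a4; 0,0,0,0,4,0,2*a2,a3] := by
    ext i j
    fin_cases i <;> fin_cases j <;> simp [discEntry, h0,h1,h2,h3,h4]
  unfold discD discMinor
  refine (congrArg Matrix.det this).trans ?_
  simp [Matrix.det_succ_column_zero, Fin.sum_univ_succ, Fin.succAbove]
  ring

theorem quartic_root_split (f : Polynomial ℝ) (hf : f ≠ 0) :
    f.roots.toFinset.card =
      ((f.map (algebraMap ℝ ℂ)).roots.toFinset.filter fun z => z.im = 0).card := by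
  classical
  rw [← Finset.card_image_of_injective f.roots.toFinset Complex.ofReal_injective]
  congr 1
  have hm : f.map (algebraMap ℝ ℂ) ≠ 0 := (Polynomial.map_ne_zero_iff (algebraMap ℝ ℂ).injective).2 hf
  have key : ∀ x : ℝ, (f.map (algebraMap ℝ ℂ)).eval (x : ℂ) = ((f.eval x : ℝ) : ℂ) := by
    intro x
    exact Polynomial.eval_map_apply (algebraMap ℝ ℂ) x
  ext z
  simp only [Finset.mem_image, Multiset.mem_toFinset, Finset.mem_filter, Polynomial.mem_roots hf,
    Polynomial.mem_roots hm, Polynomial.IsRoot.def]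
  constructor
  · rintro ⟨x, hx, rfl⟩
    rw [key, hx]
    simp
  · rintro ⟨h, hz⟩
    have hz' : ((z.re : ℝ) : ℂ) = z := Complex.ext (by simp) (by simp [hz])
    refine ⟨z.re, ?_, hz'⟩
    rw [← hz', key] at h
    exact_mod_cast h

theorem quartic_four_roots (a2 a3 a4 : ℂ) : ∃ z1 z2 z3 z4 : ℂ,
    z1 + z2 + z3 + z4 = 0 ∧ a2 = z1*z2+z1*z3+z1*z4+z2*z3+z2*z4+z3*z4 ∧
    a3 = -(z1*z2*z3+z1*z2*z4+z1*z3*z4+z2*z3*z4) ∧ a4 = z1*z2*z3*z4 := by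
  set g : Polynomial ℂ := X ^ 4 + C a2 * X ^ 2 + C a3 * X + C a4 with hg
  have hd : g.natDegree = 4 := by rw [hg]; compute_degree!
  have hmon : g.Monic := by rw [hg]; monicity!
  have hs : g.Splits := IsAlgClosed.splits g
  have hc : g.roots.card = 4 := by rw [← hd]; exact hs.natDegree_eq_card_roots.symm
  have hprod := hs.eq_prod_roots_of_monic hmon
  obtain ⟨z1, z2, z3, z4, hz⟩ : ∃ z1 z2 z3 z4, g.roots = {z1, z2, z3, z4} := by
    obtain ⟨l, hl⟩ := Quot.exists_rep g.roots
    have hl' : g.roots = (l : Multiset ℂ) := hl.symm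
    rw [hl'] at hc
    simp at hc
    obtain ⟨a, b, c, d, rfl⟩ : ∃ a b c d, l = [a,b,c,d] := by
      match l, hc with
      | [a,b,c,d], _ => exact ⟨a,b,c,d,rfl⟩
    exact ⟨a,b,c,d,hl'⟩
  have hp : g = (X - C z1) * (X - C z2) * (X - C z3) * (X - C z4) := by
    rw [hprod, hz]; simp [mul_assoc]
  have hp' : g = X^4 + C (-(z1+z2+z3+z4)) * X^3
      + C (z1*z2+z1*z3+z1*z4+z2*z3+z2*z4+z3*z4) * X^2
      + C (-(z1*z2*z3+z1*z2*z4+z1*z3*z4+z2*z3*z4)) * X + C (z1*z2*z3*z4) := by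
    rw [hp]; simp only [map_neg, map_add, map_mul]; ring
  rw [hg] at hp'
  have gen : ∀ b3 b2 b1 b0 : ℂ, X ^ 4 + C a2 * X ^ 2 + C a3 * X + C a4
      = X^4 + C b3 * X^3 + C b2 * X^2 + C b1 * X + C b0 →
      b3 = 0 ∧ a2 = b2 ∧ a3 = b1 ∧ a4 = b0 := by
    intro b3 b2 b1 b0 h
    have e3 := congrArg (fun p => p.coeff 3) h
    have e2 := congrArg (fun p => p.coeff 2) h
    have e1 := congrArg (fun p => p.coeff 1) h
    have e0 := congrArg (fun p => p.coeff 0) h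
    simp [coeff_X, coeff_C, coeff_X_pow] at e0 e1 e2 e3
    exact ⟨by first | exact e3 | exact e3.symm, e2, e1, e0⟩
  obtain ⟨e3, e2, e1, e0⟩ := gen _ _ _ _ hp'
  exact ⟨z1, z2, z3, z4, by linear_combination -e3, e2, e1, e0⟩

theorem quartic_factor_of_im (a2 a3 a4 : ℝ) (z : ℂ) (hz : z^4 + a2*z^2 + a3*z + a4 = 0)
    (him : z.im ≠ 0) :
    ∃ p q r : ℝ, a2 = q + r - p^2 ∧ a3 = p*(r-q) ∧ a4 = q*r := by
  obtain ⟨x, y⟩ := z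
  simp only at him
  have h1 := congrArg Complex.re hz
  have h2 := congrArg Complex.im hz
  simp [pow_succ] at h1 h2
  have h3 : a3 = -2*x*((a2 - (x^2+y^2) + 4*x^2)-(x^2+y^2)) := by
    apply mul_right_cancel₀ him
    linear_combination h2
  refine ⟨-2*x, x^2+y^2, a2 - (x^2+y^2) + 4*x^2, by ring, h3, ?_⟩
  linear_combination h1 - x*h3

theorem quartic_factor (a2 a3 a4 : ℝ) :
    ∃ p q r : ℝ, a2 = q + r - p^2 ∧ a3 = p*(r-q) ∧ a4 = q*r := by
  obtain ⟨z1, z2, z3, z4, e3, e2, e1, e0⟩ := quartic_four_roots a2 a3 a4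
  have hfac : ∀ z : ℂ, z^4 + a2*z^2 + a3*z + a4 = (z-z1)*(z-z2)*(z-z3)*(z-z4) := by
    intro z
    rw [e2, e1, e0]
    linear_combination z^3 * e3
  by_cases h1 : z1.im = 0
  swap
  · exact quartic_factor_of_im a2 a3 a4 z1 (by rw [hfac]; ring) h1
  by_cases h2 : z2.im = 0
  swap
  · exact quartic_factor_of_im a2 a3 a4 z2 (by rw [hfac]; ring) h2
  by_cases h3 : z3.im = 0
  swap
  · exact quartic_factor_of_im a2 a3 a4 z3 (by rw [hfac]; ring) h3
  by_cases h4 : z4.im = 0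
  swap
  · exact quartic_factor_of_im a2 a3 a4 z4 (by rw [hfac]; ring) h4
  have r3 := congrArg Complex.re e3
  have r2 := congrArg Complex.re e2
  have r1 := congrArg Complex.re e1
  have r0 := congrArg Complex.re e0
  simp [h1, h2, h3, h4] at r0 r1 r2 r3
  have r4 : z4.re = -(z1.re+z2.re+z3.re) := by linarith
  rw [r4] at r0 r1 r2
  refine ⟨-(z1.re+z2.re), z1.re*z2.re, z3.re*z4.re, ?_, ?_, ?_⟩
  · rw [r4, r2]; ring
  · rw [r4, r1]; ring
  · rw [r4, r0]; ring

theorem real_csqrt (u : ℝ) : ∃ α : ℂ, α^2 = u ∧ (0 ≤ u → α.im = 0) ∧ (u < 0 → α.im ≠ 0) := by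
  rcases le_or_gt 0 u with h | h
  · refine ⟨(Real.sqrt u : ℝ), ?_, fun _ => by simp, fun h' => by linarith⟩
    rw [← Complex.ofReal_pow, Real.sq_sqrt h]
  · refine ⟨(Real.sqrt (-u) : ℝ) * Complex.I, ?_, fun h' => by linarith, fun _ => ?_⟩
    · rw [mul_pow, ← Complex.ofReal_pow, Real.sq_sqrt (by linarith)]; simp
    · simp [Real.sqrt_eq_zero', h]

theorem quartic_d3_pos (s u v : ℝ) (hs : 0 ≤ s) (hu : 0 < u) (hv : 0 < v)
    (hR : ¬ (s = 0 ∧ u = v)) :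
    0 < (u+v)*(4*s-(u+v))^2 + 4*(u*v)*(16*s-(u+v)) := by
  have hw : 0 < u + v := by linarith
  have hm : 0 < u * v := mul_pos hu hv
  rcases le_or_gt ((u+v)^2) (8*(u*v)) with h | h
  · have e : (u+v)*(4*s-(u+v))^2 + 4*(u*v)*(16*s-(u+v))
      = 16*(u+v)*s^2 + 8*s*(8*(u*v)-(u+v)^2) + (u+v)*(u-v)^2 := by ring
    rw [e]
    have t2 : 0 ≤ 8*s*(8*(u*v)-(u+v)^2) := mul_nonneg (by linarith) (by linarith)
    rcases hs.eq_or_lt with h0 | h0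
    · have : u - v ≠ 0 := fun h' => hR ⟨h0.symm, by linarith⟩
      positivity
    · positivity
  · have e : (u+v) * ((u+v)*(4*s-(u+v))^2 + 4*(u*v)*(16*s-(u+v)))
      = (4*(u+v)*s - ((u+v)^2-8*(u*v)))^2 + 4*(u*v)*(3*(u+v)^2-16*(u*v)) := by ring
    have : 0 < (u+v) * ((u+v)*(4*s-(u+v))^2 + 4*(u*v)*(16*s-(u+v))) := by
      rw [e]
      have : 0 < 4*(u*v)*(3*(u+v)^2-16*(u*v)) := mul_pos (by linarith) (by linarith)
      positivity
    exact pos_of_mul_pos_right this hw.le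

theorem quartic_d3_nonpos (s u v : ℝ) (hs : 0 ≤ s) (hu : u < 0) (hv : v < 0)
    (hd : 0 < 2*s + (u+v)) :
    (u+v)*(4*s-(u+v))^2 + 4*(u*v)*(16*s-(u+v)) ≤ 0 := by
  have hm : 4 * (u*v) ≤ (u+v)^2 := by nlinarith [sq_nonneg (u-v)]
  have h1 : 4*(u*v)*(16*s-(u+v)) ≤ (u+v)^2*(16*s-(u+v)) :=
    mul_le_mul_of_nonneg_right hm (by linarith)
  have h2 : (u+v)*(4*s-(u+v))^2 + (u+v)^2*(16*s-(u+v)) = 8*(u+v)*s*(2*s+(u+v)) := by ring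
  have h3 : 8*(u+v)*s*(2*s+(u+v)) ≤ 0 := by
    have : 0 ≤ -(u+v)*s*(2*s+(u+v)) := mul_nonneg (mul_nonneg (by linarith) hs) hd.le
    linarith
  linarith

/-- Counting the real and non-real roots of a quartic given as a product of two quadratics. -/
theorem quartic_count (p q r : ℝ) (f : Polynomial ℝ)
    (hf : f = X ^ 4 + C (q + r - p^2) * X ^ 2 + C (p*(r-q)) * X + C (q*r))
    (rc nc : ℕ) (hrc : f.roots.toFinset.card = rc)
    (hnc : ((f.map (algebraMap ℝ ℂ)).roots.toFinset.filter fun z => z.im ≠ 0).card = nc) :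
    ((p^2-4*q)*(p^2-4*r)*((r-q)^2+2*p^2*(q+r))^2 = 0 → rc + nc ≤ 3) ∧
    ((p^2-4*q)*(p^2-4*r)*((r-q)^2+2*p^2*(q+r))^2 ≠ 0 →
      (0 < p^2-4*q → 0 < p^2-4*r → rc = 4 ∧ nc = 0) ∧
      (p^2-4*q < 0 → p^2-4*r < 0 → rc = 0 ∧ nc = 4) ∧
      ((p^2-4*q)*(p^2-4*r) < 0 → rc = 2 ∧ nc = 2)) := by
  classical
  have hmon : f.Monic := by rw [hf]; monicity!
  rw [quartic_root_split f hmon.ne_zero] at hrc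
  obtain ⟨α, hα, hα1, hα2⟩ := real_csqrt (p^2-4*q)
  obtain ⟨β, hβ, hβ1, hβ2⟩ := real_csqrt (p^2-4*r)
  push_cast at hα hβ
  obtain ⟨z1, hz1⟩ : ∃ z1 : ℂ, z1 = (-p+α)/2 := ⟨_, rfl⟩
  obtain ⟨z2, hz2⟩ : ∃ z2 : ℂ, z2 = (-p-α)/2 := ⟨_, rfl⟩
  obtain ⟨z3, hz3⟩ : ∃ z3 : ℂ, z3 = (p+β)/2 := ⟨_, rfl⟩
  obtain ⟨z4, hz4⟩ : ∃ z4 : ℂ, z4 = (p-β)/2 := ⟨_, rfl⟩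
  have s12 : z1 + z2 = -p := by rw [hz1, hz2]; ring
  have p12 : z1 * z2 = q := by rw [hz1, hz2]; linear_combination -hα/4
  have s34 : z3 + z4 = p := by rw [hz3, hz4]; ring
  have p34 : z3 * z4 = r := by rw [hz3, hz4]; linear_combination -hβ/4
  have hmap : f.map (algebraMap ℝ ℂ) = (X - C z1) * ((X - C z2) * ((X - C z3) * (X - C z4))) := by
    have e1 : (X - C z1) * (X - C z2) = X^2 + C (p:ℂ) * X + C (q:ℂ) := by
      have : (p:ℂ) = -(z1+z2) := by rw [s12]; ring
      rw [this, ← p12]; simp only [map_neg, map_add, map_mul]; ring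
    have e2 : (X - C z3) * (X - C z4) = X^2 - C (p:ℂ) * X + C (r:ℂ) := by
      rw [← s34, ← p34]; simp only [map_add, map_mul]; ring
    rw [← mul_assoc, e1, e2, hf]
    simp
    ring
  have hroots : (f.map (algebraMap ℝ ℂ)).roots.toFinset = {z1, z2, z3, z4} := by
    have hne : f.map (algebraMap ℝ ℂ) ≠ 0 := (hmon.map _).ne_zero
    ext z
    rw [Multiset.mem_toFinset, Polynomial.mem_roots hne, hmap]
    simp [sub_eq_zero]
  rw [hroots] at hrc hnc
  have hsum : rc + nc = ({z1, z2, z3, z4} : Finset ℂ).card := by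
    rw [← hrc, ← hnc]
    exact Finset.card_filter_add_card_filter_not (fun z : ℂ => z.im = 0)
  have hD : (((p^2-4*q)*(p^2-4*r)*((r-q)^2+2*p^2*(q+r))^2 : ℝ) : ℂ)
      = (z1-z2)^2 * (z3-z4)^2 * ((z1-z3)*(z1-z4)*(z2-z3)*(z2-z4))^2 := by
    have e1 : (z1-z2)^2 = (p:ℂ)^2-4*q := by linear_combination (z1+z2-p)*s12 - 4*p12
    have e2 : (z3-z4)^2 = (p:ℂ)^2-4*r := by linear_combination (z3+z4+p)*s34 - 4*p34
    have e3 : (z1-z3)*(z1-z4)*(z2-z3)*(z2-z4) = ((r:ℂ)-q)^2+2*p^2*(q+r) := by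
      have f1 : (z1-z3)*(z1-z4) = z1^2 - p*z1 + r := by linear_combination p34 - z1*s34
      have f2 : (z2-z3)*(z2-z4) = z2^2 - p*z2 + r := by linear_combination p34 - z2*s34
      have : z2 = -p - z1 := by linear_combination s12
      calc (z1-z3)*(z1-z4)*(z2-z3)*(z2-z4)
          = (z1^2 - p*z1 + r) * (z2^2 - p*z2 + r) := by rw [← f1, ← f2]; ring
        _ = (z1*z2)^2 - p*(z1*z2)*(z1+z2) + r*((z1+z2)^2-2*(z1*z2)) + p^2*(z1*z2)
            - p*r*(z1+z2) + r^2 := by ring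
        _ = _ := by rw [p12, s12]; ring
    rw [e1, e2, e3]; push_cast; ring
  constructor
  · intro h0
    rw [hsum]
    rw [h0] at hD
    have hD' : (z1-z2)^2 * (z3-z4)^2 * ((z1-z3)*(z1-z4)*(z2-z3)*(z2-z4))^2 = 0 := by
      rw [← hD]; simp
    simp only [mul_eq_zero, pow_eq_zero_iff, ne_eq, OfNat.ofNat_ne_zero, not_false_eq_true,
      sub_eq_zero] at hD'
    have h3 : ∀ a b c : ℂ, ({a, b, c} : Finset ℂ).card ≤ 3 := fun a b c => Finset.card_le_three
    rcases hD' with (h | h) | ((h | h) | h) | h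
    · rw [h]; simpa using h3 z2 z3 z4
    · rw [h]; simpa using h3 z1 z2 z4
    · rw [h]
      have : ({z3, z2, z3, z4} : Finset ℂ) = {z2, z3, z4} := by ext; simp
      rw [this]; exact h3 _ _ _
    · rw [h]
      have : ({z4, z2, z3, z4} : Finset ℂ) = {z2, z3, z4} := by ext; simp
      rw [this]; exact h3 _ _ _
    · rw [h]
      have : ({z1, z3, z3, z4} : Finset ℂ) = {z1, z3, z4} := by ext; simp
      rw [this]; exact h3 _ _ _
    · rw [h]
      have : ({z1, z4, z3, z4} : Finset ℂ) = {z1, z3, z4} := by ext; simp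
      rw [this]; exact h3 _ _ _
  · intro h0
    have hD' : (z1-z2)^2 * (z3-z4)^2 * ((z1-z3)*(z1-z4)*(z2-z3)*(z2-z4))^2 ≠ 0 := by
      rw [← hD]; exact_mod_cast h0
    simp only [ne_eq, mul_eq_zero, pow_eq_zero_iff, OfNat.ofNat_ne_zero, not_false_eq_true,
      sub_eq_zero, not_or] at hD'
    obtain ⟨⟨n12, n34⟩, ⟨⟨n13, n14⟩, n23⟩, n24⟩ := hD'
    have i1 : z1.im = α.im / 2 := by rw [hz1]; simp
    have i2 : z2.im = -α.im / 2 := by rw [hz2]; simp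
    have i3 : z3.im = β.im / 2 := by rw [hz3]; simp
    have i4 : z4.im = -β.im / 2 := by rw [hz4]; simp
    have hcard : ({z1, z2, z3, z4} : Finset ℂ).card = 4 := by
      simp [n12, n34, n13, n14, n23, n24]
    rw [hcard] at hsum
    have hrc' : ∀ k, rc = k → rc = k ∧ nc = 4 - k := fun k hk => ⟨hk, by omega⟩
    refine ⟨fun hu hv => ?_, fun hu hv => ?_, fun huv => ?_⟩
    · refine hrc' 4 ?_
      rw [← hrc]
      simp [Finset.filter_insert, Finset.filter_singleton, i1, i2, i3, i4, hα1 hu.le, hβ1 hv.le,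
        n12, n34, n13, n14, n23, n24]
    · refine hrc' 0 ?_
      rw [← hrc]
      simp [Finset.filter_insert, Finset.filter_singleton, i1, i2, i3, i4, hα2 hu, hβ2 hv]
    · refine hrc' 2 ?_
      rw [← hrc]
      rcases mul_neg_iff.1 huv with ⟨hu, hv⟩ | ⟨hu, hv⟩
      · simp [Finset.filter_insert, Finset.filter_singleton, i1, i2, i3, i4, hα1 hu.le, hβ2 hv,
          n12]
      · simp [Finset.filter_insert, Finset.filter_singleton, i1, i2, i3, i4, hα2 hu, hβ1 hv.le,
          n34]

/-- **Nondegenerate-root classification of a trace-free real quartic.**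
Let `f = x⁴ + a₂x² + a₃x + a₄` with discriminant sequence `{⁴D₁, …, ⁴D₄}`.  Then:
(i) `f` has four distinct real roots iff `⁴D₄ > 0`, `⁴D₃ > 0` and `⁴D₂ > 0`;
(ii) `f` has two distinct pairs of complex-conjugate non-real roots (and no real roots) iff
`⁴D₄ > 0` and not both `⁴D₃ > 0` and `⁴D₂ > 0`;
(iii) `f` has exactly one pair of complex-conjugate non-real roots together with two distinct
real roots iff `⁴D₄ < 0`. -/
theorem stmt18 (a2 a3 a4 : ℝ) (f : Polynomial ℝ)
    (hf : f = X ^ 4 + C a2 * X ^ 2 + C a3 * X + C a4) :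
    (f.roots.toFinset.card = 4 ↔
      (0 < polyDiscD 4 f 4 ∧ 0 < polyDiscD 4 f 3 ∧ 0 < polyDiscD 4 f 2)) ∧
    ((((f.map (algebraMap ℝ ℂ)).roots.toFinset.filter fun z => z.im ≠ 0).card = 4 ∧
        f.roots.toFinset.card = 0) ↔
      (0 < polyDiscD 4 f 4 ∧ ¬ (0 < polyDiscD 4 f 3 ∧ 0 < polyDiscD 4 f 2))) ∧
    ((((f.map (algebraMap ℝ ℂ)).roots.toFinset.filter fun z => z.im ≠ 0).card = 2 ∧
        f.roots.toFinset.card = 2) ↔ polyDiscD 4 f 4 < 0) := by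
  obtain ⟨p, q, r, e2, e3, e4⟩ := quartic_factor a2 a3 a4
  have c0 : coeffSeq 4 f 0 = 1 := by
    simp [coeffSeq, hf, coeff_X, coeff_C, coeff_X_pow]
  have c1 : coeffSeq 4 f 1 = 0 := by
    simp [coeffSeq, hf, coeff_X, coeff_C, coeff_X_pow]
  have c2 : coeffSeq 4 f 2 = a2 := by
    simp [coeffSeq, hf, coeff_X, coeff_C, coeff_X_pow]
  have c3 : coeffSeq 4 f 3 = a3 := by
    simp [coeffSeq, hf, coeff_X, coeff_C, coeff_X_pow]
  have c4 : coeffSeq 4 f 4 = a4 := by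
    simp [coeffSeq, hf, coeff_X, coeff_C, coeff_X_pow]
  obtain ⟨u, hu⟩ : ∃ u, u = p^2-4*q := ⟨_, rfl⟩
  obtain ⟨v, hv⟩ : ∃ v, v = p^2-4*r := ⟨_, rfl⟩
  have hq : q = (p^2-u)/4 := by rw [hu]; ring
  have hr : r = (p^2-v)/4 := by rw [hv]; ring
  have D2 : polyDiscD 4 f 2 = 2*(2*p^2+(u+v)) := by
    rw [polyDiscD, quartic_d2 a2 a3 _ c0 c1 c2 c3, e2, hq, hr]; ring
  have D3 : polyDiscD 4 f 3
      = ((u+v)*(4*p^2-(u+v))^2 + 4*(u*v)*(16*p^2-(u+v)))/8 := by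
    rw [polyDiscD, quartic_d3 a2 a3 a4 _ c0 c1 c2 c3 c4, e2, e3, e4, hq, hr]; ring
  have D4 : polyDiscD 4 f 4 = u*v*((r-q)^2+2*p^2*(q+r))^2 := by
    rw [polyDiscD, quartic_d4 a2 a3 a4 _ c0 c1 c2 c3 c4, e2, e3, e4, hu, hv]; ring
  obtain ⟨rc, hrc⟩ : ∃ rc, f.roots.toFinset.card = rc := ⟨_, rfl⟩
  obtain ⟨nc, hnc⟩ : ∃ nc, ((f.map (algebraMap ℝ ℂ)).roots.toFinset.filter
    fun z => z.im ≠ 0).card = nc := ⟨_, rfl⟩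
  obtain ⟨H0, H1⟩ := quartic_count p q r f (by rw [hf, e2, e3, e4]) rc nc hrc hnc
  rw [← hu, ← hv, ← D4] at H0 H1
  rw [hrc, hnc]
  by_cases hD : polyDiscD 4 f 4 = 0
  · have := H0 hD
    rw [hD]
    simp only [lt_irrefl, false_and, iff_false]
    omega
  obtain ⟨K1, K2, K3⟩ := H1 hD
  have hne : u*v*((r-q)^2+2*p^2*(q+r))^2 ≠ 0 := by rw [← D4]; exact hD
  have hR : (r-q)^2+2*p^2*(q+r) ≠ 0 := fun h => hne (by rw [h]; ring)
  have hu0 : u ≠ 0 := fun h => hne (by rw [h]; ring)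
  have hv0 : v ≠ 0 := fun h => hne (by rw [h]; ring)
  have hR2 : 0 < ((r-q)^2+2*p^2*(q+r))^2 := by positivity
  have neg_case : u*v < 0 → (rc = 4 ↔ (0 < polyDiscD 4 f 4 ∧ 0 < polyDiscD 4 f 3 ∧
      0 < polyDiscD 4 f 2)) ∧ (nc = 4 ∧ rc = 0 ↔ (0 < polyDiscD 4 f 4 ∧
      ¬ (0 < polyDiscD 4 f 3 ∧ 0 < polyDiscD 4 f 2))) ∧
      (nc = 2 ∧ rc = 2 ↔ polyDiscD 4 f 4 < 0) := by
    intro huv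
    obtain ⟨k1, k2⟩ := K3 huv
    have hlt : polyDiscD 4 f 4 < 0 := by rw [D4]; exact mul_neg_of_neg_of_pos huv hR2
    have hn : ¬ 0 < polyDiscD 4 f 4 := by linarith
    rw [k1, k2]
    simp [hlt, hn]
  rcases lt_or_gt_of_ne hu0 with hu1 | hu1 <;> rcases lt_or_gt_of_ne hv0 with hv1 | hv1
  · obtain ⟨k1, k2⟩ := K2 hu1 hv1
    have hgt : 0 < polyDiscD 4 f 4 := by rw [D4]; exact mul_pos (mul_pos_of_neg_of_neg hu1 hv1) hR2
    have hn : ¬ polyDiscD 4 f 4 < 0 := by linarith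
    have hnot : ¬ (0 < polyDiscD 4 f 3 ∧ 0 < polyDiscD 4 f 2) := by
      rintro ⟨h3, h2⟩
      rw [D2] at h2
      rw [D3] at h3
      have := quartic_d3_nonpos (p^2) u v (sq_nonneg p) hu1 hv1 (by linarith)
      linarith
    rw [k1, k2]
    simp only [hgt, hn, hnot]
    norm_num
  · exact neg_case (mul_neg_of_neg_of_pos hu1 hv1)
  · exact neg_case (mul_neg_of_pos_of_neg hu1 hv1)
  · obtain ⟨k1, k2⟩ := K1 hu1 hv1
    have hgt : 0 < polyDiscD 4 f 4 := by rw [D4]; exact mul_pos (mul_pos hu1 hv1) hR2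
    have hn : ¬ polyDiscD 4 f 4 < 0 := by linarith
    have h2 : 0 < polyDiscD 4 f 2 := by rw [D2]; positivity
    have h3 : 0 < polyDiscD 4 f 3 := by
      rw [D3]
      have := quartic_d3_pos (p^2) u v (sq_nonneg p) hu1 hv1 (by
        rintro ⟨h, h'⟩
        apply hR
        rw [hq, hr, h, h']; ring)
      linarith
    rw [k1, k2]
    simp only [hgt, hn, h2, h3]
    norm_num
end
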